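/- arXiv:2309.01514 — 2 statements merged into one kernel-verified Lean document; each statement's English description precedes it below -/
import Mathlib

section
/- Assume (A0), (A1), (A2), (A3), and let x* be a positive solution of equation (*) satisfying (A4): there exist m*, M* > 0 and T > 0 such that m* ≤ x*(t) ≤ M* for all t ≥ T − τ, and a⁺M*((M*/m*) e^{ζ⁺} − 1) ≤ 1, where ζ⁺ = max_{1≤j≤m} limsup_{t→∞} ∫_{t−σ_j(t)}^t δ(s) ds. Then x* is globally attractive: every positive solution x of (*) satisfies lim_{t→∞} (x(t) − x*(t)) = 0. -/
open Real Filter MeasureTheory Set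

noncomputable section

/-- A positive (admissible) solution of the nonautonomous Nicholson equation (*)
`x'(t) = ∑ j, p j t * x (t - τd j t) * exp (-(a j t * x (t - σd j t))) - δ t * x t`,
considered for `t ≥ 0`, with nonnegative continuous initial data on `[-τ, 0)` and `x 0 > 0`. -/
def IsPosSol (m : ℕ) (p a : Fin m → ℝ → ℝ) (δ : ℝ → ℝ)
    (τd σd : Fin m → ℝ → ℝ) (τ : ℝ) (x : ℝ → ℝ) : Prop :=
  ContinuousOn x (Ici (-τ)) ∧
  (∀ θ ∈ Ico (-τ) (0:ℝ), 0 ≤ x θ) ∧ 0 < x 0 ∧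
  ∀ t ≥ (0:ℝ), HasDerivWithinAt x
      ((∑ j, p j t * x (t - τd j t) * Real.exp (-(a j t * x (t - σd j t)))) - δ t * x t)
      (Ici 0) t

/-- Hypothesis (A0): the coefficients `p j, a j, δ` are continuous and positive on `[0,∞)`;
the delays `τd j, σd j` are continuous, nonnegative and bounded; and each `a j` is bounded
below and above by positive constants. -/
def HypA0 (m : ℕ) (p a : Fin m → ℝ → ℝ) (δ : ℝ → ℝ)
    (τd σd : Fin m → ℝ → ℝ) : Prop :=
  (∀ j, ContinuousOn (p j) (Ici 0) ∧ ∀ t ≥ (0:ℝ), 0 < p j t) ∧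
  (∀ j, ContinuousOn (a j) (Ici 0) ∧
      ∃ c C : ℝ, 0 < c ∧ ∀ t ≥ (0:ℝ), c ≤ a j t ∧ a j t ≤ C) ∧
  (ContinuousOn δ (Ici 0) ∧ ∀ t ≥ (0:ℝ), 0 < δ t) ∧
  (∀ j, ContinuousOn (τd j) (Ici 0) ∧ ContinuousOn (σd j) (Ici 0) ∧
      (∀ t ≥ (0:ℝ), 0 ≤ τd j t ∧ 0 ≤ σd j t) ∧
      ∃ B : ℝ, ∀ t ≥ (0:ℝ), τd j t ≤ B ∧ σd j t ≤ B)

/-- `τ = max_j max (sup_t τd j t, sup_t σd j t)`: the supremum of all the delays. -/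
def IsMaxDelay (m : ℕ) (τd σd : Fin m → ℝ → ℝ) (τ : ℝ) : Prop :=
  IsLUB {r : ℝ | ∃ j : Fin m, ∃ t : ℝ, 0 ≤ t ∧ (r = τd j t ∨ r = σd j t)} τ

/-- Hypothesis (A1): `liminf_{t→∞} p(t)/δ(t) > 1` and `limsup_{t→∞} p(t)/δ(t) < ∞`. -/
def HypA1 (m : ℕ) (p : Fin m → ℝ → ℝ) (δ : ℝ → ℝ) : Prop :=
  1 < Filter.liminf (fun t => (∑ j, p j t) / δ t) Filter.atTop ∧
  Filter.IsBoundedUnder (· ≤ ·) Filter.atTop (fun t => (∑ j, p j t) / δ t)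

/-- Hypothesis (A2): `limsup_{t→∞} ∫_{t-τ}^t p(s) ds < ∞`. -/
def HypA2 (m : ℕ) (p : Fin m → ℝ → ℝ) (τ : ℝ) : Prop :=
  Filter.IsBoundedUnder (· ≤ ·) Filter.atTop (fun t => ∫ s in t - τ..t, (∑ j, p j s))

/-- Hypothesis (A3): `∫_0^∞ δ(s) ds = ∞`. -/
def HypA3 (δ : ℝ → ℝ) : Prop :=
  Filter.Tendsto (fun t => ∫ s in (0:ℝ)..t, δ s) Filter.atTop Filter.atTop

/-- Normal form of the equation for the quotient `w = x / x*`. -/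
structure NF (m : ℕ) (P b τd σd : Fin m → ℝ → ℝ) (w Φ : ℝ → ℝ)
    (T0 τ B b0 C : ℝ) : Prop where
  hm : 0 < m
  hτ : 0 ≤ τ
  hb0 : 0 < b0
  wc : ContinuousOn w (Ici (T0 - τ))
  wpos : ∀ t ≥ T0 - τ, 0 < w t
  wder : ∀ t ≥ T0, HasDerivAt w (∑ j, P j t *
    (w (t - τd j t) * Real.exp (-(b j t * (w (t - σd j t) - 1))) - w t)) t
  Φder : ∀ t ≥ T0, HasDerivAt Φ (∑ j, P j t) t
  Ppos : ∀ t ≥ T0, ∀ j, 0 < P j t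
  bl : ∀ t ≥ T0, ∀ j, b0 ≤ b j t
  bu : ∀ t ≥ T0, ∀ j, b j t ≤ B
  τl : ∀ t ≥ T0, ∀ j, 0 ≤ τd j t
  τu : ∀ t ≥ T0, ∀ j, τd j t ≤ τ
  σl : ∀ t ≥ T0, ∀ j, 0 ≤ σd j t
  σu : ∀ t ≥ T0, ∀ j, σd j t ≤ τ
  ΦC : ∀ t ≥ T0 + τ, Φ t - Φ (t - τ) ≤ C
  Φinf : Tendsto Φ atTop atTop

lemma deriv_nonneg_of_left_max {f : ℝ → ℝ} {d a t : ℝ} (hf : HasDerivAt f d t) (hat : a < t)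
    (h : ∀ s ∈ Icc a t, f s ≤ f t) : 0 ≤ d := by
  have h1 := (hasDerivWithinAt_iff_tendsto_slope' (s := Iio t) (by simp)).1 hf.hasDerivWithinAt
  refine ge_of_tendsto h1 ?_
  have : Ioo a t ∈ nhdsWithin t (Iio t) := Ioo_mem_nhdsLT hat
  filter_upwards [this] with s hs
  rw [slope_def_field]
  apply div_nonneg_of_nonpos
  · linarith [h s ⟨hs.1.le, hs.2.le⟩]
  · linarith [hs.2]

lemma eventually_le_aux {f Φ f' Q : ℝ → ℝ} {T1 c ε : ℝ} (hε : 0 < ε)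
    (hf : ∀ t ≥ T1, HasDerivAt f (f' t) t) (hΦ : ∀ t ≥ T1, HasDerivAt Φ (Q t) t)
    (hQ : ∀ t ≥ T1, 0 < Q t) (h : ∀ t ≥ T1, c ≤ f t → f' t ≤ -ε * Q t)
    (hinf : Tendsto Φ atTop atTop) : ∀ᶠ t in atTop, f t ≤ c := by
  have key : ∃ t0 ≥ T1, f t0 ≤ c := by
    by_contra hcon
    push Not at hcon
    have hanti : AntitoneOn (fun t => f t + ε * Φ t) (Ici T1) := by
      apply antitoneOn_of_deriv_nonpos (convex_Ici T1)
      · intro t ht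
        exact ((hf t ht).add ((hΦ t ht).const_mul ε)).continuousAt.continuousWithinAt
      · intro t ht
        rw [interior_Ici] at ht
        exact ((hf t (le_of_lt ht)).add
          ((hΦ t (le_of_lt ht)).const_mul ε)).differentiableAt.differentiableWithinAt
      · intro t ht
        rw [interior_Ici] at ht
        have ht' : t ≥ T1 := le_of_lt ht
        have := ((hf t ht').add ((hΦ t ht').const_mul ε)).deriv
        have h2 : deriv (fun t => f t + ε * Φ t) t = f' t + ε * Q t := this
        rw [h2]
        linarith [h t ht' (hcon t ht').le]
    obtain ⟨t, ht1, ht2⟩ := ((hinf.eventually_gt_atTop ((f T1 + ε * Φ T1 - c) / ε)).and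
      (eventually_ge_atTop T1)).exists
    have h3 := hanti (self_mem_Ici : T1 ∈ Ici T1) (show t ∈ Ici T1 from ht2) ht2
    have h4 := hcon t ht2
    rw [div_lt_iff₀ hε] at ht1
    simp only at h3
    nlinarith
  obtain ⟨t0, ht0, hft0⟩ := key
  filter_upwards [eventually_ge_atTop t0] with t ht
  have hT : ∀ s ∈ Icc t0 t, s ≥ T1 := fun s hs => le_trans ht0 hs.1
  refine image_le_of_deriv_right_lt_deriv_boundary (f := f) (f' := f') (a := t0) (b := t)
    (B := fun _ => c) (B' := fun _ => 0) ?_ ?_ hft0 ?_ ?_ (right_mem_Icc.2 ht)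
  · intro s hs
    exact (hf s (hT s hs)).continuousAt.continuousWithinAt
  · intro s hs
    exact (hf s (hT s ⟨hs.1, hs.2.le⟩)).hasDerivWithinAt
  · intro s
    exact hasDerivAt_const s c
  · intro s hs hfs
    have h1 := hT s ⟨hs.1, hs.2.le⟩
    have h2 := h s h1 (le_of_eq hfs.symm)
    nlinarith [hQ s h1]

namespace NF

variable {m : ℕ} {P b τd σd : Fin m → ℝ → ℝ} {w Φ : ℝ → ℝ} {T0 τ B b0 C : ℝ}

lemma Qpos (hN : NF m P b τd σd w Φ T0 τ B b0 C) {t : ℝ} (ht : t ≥ T0) : 0 < ∑ j, P j t := by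
  have : Nonempty (Fin m) := ⟨⟨0, hN.hm⟩⟩
  exact Finset.sum_pos (fun j _ => hN.Ppos t ht j) Finset.univ_nonempty

lemma Bpos (hN : NF m P b τd σd w Φ T0 τ B b0 C) : 0 < B :=
  lt_of_lt_of_le hN.hb0 ((hN.bl T0 le_rfl ⟨0, hN.hm⟩).trans (hN.bu T0 le_rfl ⟨0, hN.hm⟩))

lemma Φmono (hN : NF m P b τd σd w Φ T0 τ B b0 C) : MonotoneOn Φ (Ici T0) := by
  apply monotoneOn_of_deriv_nonneg (convex_Ici T0)
  · intro t ht
    exact (hN.Φder t ht).continuousAt.continuousWithinAt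
  · intro t ht
    rw [interior_Ici] at ht
    exact (hN.Φder t (le_of_lt ht)).differentiableAt.differentiableWithinAt
  · intro t ht
    rw [interior_Ici] at ht
    rw [(hN.Φder t (le_of_lt ht)).deriv]
    exact (hN.Qpos (le_of_lt ht)).le

lemma Φle (hN : NF m P b τd σd w Φ T0 τ B b0 C) {s t : ℝ} (hs : T0 ≤ s) (hst : s ≤ t) :
    Φ s ≤ Φ t := hN.Φmono hs (le_trans hs hst) hst

lemma der_aux (hN : NF m P b τd σd w Φ T0 τ B b0 C) (A : ℝ) {t : ℝ} (ht : t ≥ T0) :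
    HasDerivAt (fun t => (w t - A) * Real.exp (Φ t))
      (Real.exp (Φ t) * ∑ j, P j t *
        (w (t - τd j t) * Real.exp (-(b j t * (w (t - σd j t) - 1))) - A)) t := by
  have h1 := ((hN.wder t ht).sub_const A).mul (hN.Φder t ht).exp
  refine h1.congr_deriv ?_
  simp only [mul_sub, Finset.sum_sub_distrib, ← Finset.sum_mul]
  ring

lemma compare_le (hN : NF m P b τd σd w Φ T0 τ B b0 C) {s t A : ℝ} (hs : T0 ≤ s) (hst : s ≤ t)
    (h : ∀ r ∈ Icc s t, ∀ j,
      w (r - τd j r) * Real.exp (-(b j r * (w (r - σd j r) - 1))) ≤ A) :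
    (w t - A) * Real.exp (Φ t) ≤ (w s - A) * Real.exp (Φ s) := by
  have hanti : AntitoneOn (fun t => (w t - A) * Real.exp (Φ t)) (Icc s t) := by
    apply antitoneOn_of_deriv_nonpos (convex_Icc s t)
    · intro r hr
      exact (hN.der_aux A (le_trans hs hr.1)).continuousAt.continuousWithinAt
    · intro r hr
      have hr' := interior_subset hr
      exact (hN.der_aux A (le_trans hs hr'.1)).differentiableAt.differentiableWithinAt
    · intro r hr
      have hr' := interior_subset hr
      rw [(hN.der_aux A (le_trans hs hr'.1)).deriv]
      apply mul_nonpos_of_nonneg_of_nonpos (Real.exp_pos _).le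
      apply Finset.sum_nonpos
      intro j _
      exact mul_nonpos_of_nonneg_of_nonpos (hN.Ppos r (le_trans hs hr'.1) j).le
        (sub_nonpos.2 (h r hr' j))
  exact hanti (left_mem_Icc.2 hst) (right_mem_Icc.2 hst) hst

lemma compare_ge (hN : NF m P b τd σd w Φ T0 τ B b0 C) {s t A : ℝ} (hs : T0 ≤ s) (hst : s ≤ t)
    (h : ∀ r ∈ Icc s t, ∀ j,
      A ≤ w (r - τd j r) * Real.exp (-(b j r * (w (r - σd j r) - 1)))) :
    (w s - A) * Real.exp (Φ s) ≤ (w t - A) * Real.exp (Φ t) := by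
  have hmono : MonotoneOn (fun t => (w t - A) * Real.exp (Φ t)) (Icc s t) := by
    apply monotoneOn_of_deriv_nonneg (convex_Icc s t)
    · intro r hr
      exact (hN.der_aux A (le_trans hs hr.1)).continuousAt.continuousWithinAt
    · intro r hr
      have hr' := interior_subset hr
      exact (hN.der_aux A (le_trans hs hr'.1)).differentiableAt.differentiableWithinAt
    · intro r hr
      have hr' := interior_subset hr
      rw [(hN.der_aux A (le_trans hs hr'.1)).deriv]
      apply mul_nonneg (Real.exp_pos _).le
      apply Finset.sum_nonneg
      intro j _
      exact mul_nonneg (hN.Ppos r (le_trans hs hr'.1) j).le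
        (sub_nonneg.2 (h r hr' j))
  exact hmono (left_mem_Icc.2 hst) (right_mem_Icc.2 hst) hst

lemma harnack (hN : NF m P b τd σd w Φ T0 τ B b0 C) {s t : ℝ} (hs : T0 ≤ s) (hst : s ≤ t) :
    w s ≤ w t * Real.exp (Φ t - Φ s) := by
  have h := hN.compare_ge (A := 0) hs hst (fun r hr j => mul_nonneg
    (hN.wpos _ (by
      have := hN.τu r (le_trans hs hr.1) j
      have := hr.1
      linarith)).le (Real.exp_pos _).le)
  simp only [sub_zero] at h
  rw [Real.exp_sub, mul_div_assoc', le_div_iff₀ (Real.exp_pos _)]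
  exact h

lemma upper (hN : NF m P b τd σd w Φ T0 τ B b0 C) {U V c ε D T1 : ℝ} (hT1 : T0 ≤ T1)
    (hV1 : V ≤ 1) (hw : ∀ t ≥ T1, V ≤ w t ∧ w t ≤ U)
    (hD : ∀ t ≥ T1, ∀ j, Φ t - Φ (t - σd j t) ≤ D) (hcU : c ≤ U) (hε : 0 < ε)
    (h1 : 1 + ε ≤ c - (Real.exp D - 1) * (U * Real.exp (B * (1 - V)) - c))
    (h2 : U * Real.exp (-(b0 * ε)) < c) : ∀ᶠ t in atTop, w t ≤ c := by
  have hτ := hN.hτ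
  have hU : 0 < U := lt_of_lt_of_le (hN.wpos T1 (by linarith)) (hw T1 le_rfl).2
  refine eventually_le_aux (f := w) (Φ := Φ) (T1 := T1 + 2 * τ) (sub_pos.2 h2)
    (fun t ht => hN.wder t (by linarith)) (fun t ht => hN.Φder t (by linarith))
    (fun t ht => hN.Qpos (by linarith)) ?_ hN.Φinf
  intro t ht hct
  have htT : t ≥ T0 := by linarith
  rw [Finset.mul_sum]
  apply Finset.sum_le_sum
  intro j _
  have hσ1 := hN.σl t htT j
  have hσ2 := hN.σu t htT j
  have hτ2 := hN.τu t htT j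
  set A := U * Real.exp (B * (1 - V)) with hA
  have hAU : U ≤ A := by
    rw [hA]
    apply le_mul_of_one_le_right hU.le
    apply Real.one_le_exp
    exact mul_nonneg hN.Bpos.le (by linarith)
  have hcmp := hN.compare_le (s := t - σd j t) (t := t) (A := A) (by linarith) (by linarith) (by
    intro r hr i
    have hrT : r ≥ T0 := by linarith [hr.1]
    have ha := hN.τu r hrT i
    have hb := hN.σu r hrT i
    have hbu := hN.bu r hrT i
    have hbl := hN.bl r hrT i
    have hr1 := hr.1
    have hw1 := hw (r - τd i r) (by linarith)
    have hw2 := hw (r - σd i r) (by linarith)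
    have hb0 := hN.hb0
    apply mul_le_mul hw1.2 _ (Real.exp_pos _).le hU.le
    apply Real.exp_le_exp.2
    nlinarith [mul_le_mul_of_nonneg_left hw2.1 (show 0 ≤ b i r by linarith),
      mul_le_mul_of_nonneg_right hbu (show 0 ≤ 1 - V by linarith)])
  have hΔ := hD t (by linarith) j
  have hws : 1 + ε ≤ w (t - σd j t) := by
    have e1 : Real.exp (Φ t) = Real.exp (Φ t - Φ (t - σd j t)) * Real.exp (Φ (t - σd j t)) := by
      rw [← Real.exp_add]; ring_nf
    rw [e1, ← mul_assoc] at hcmp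
    have h3 := le_of_mul_le_mul_right hcmp (Real.exp_pos _)
    have h4 := Real.exp_le_exp.2 hΔ
    have h5 := (hw t (by linarith)).2
    have h6 : (A - w t) * Real.exp (Φ t - Φ (t - σd j t)) ≤ (A - c) * Real.exp D :=
      mul_le_mul (by linarith) h4 (Real.exp_pos _).le (by linarith)
    nlinarith
  have hbl := hN.bl t htT j
  have hw1 := hw (t - τd j t) (by linarith)
  have hF : w (t - τd j t) * Real.exp (-(b j t * (w (t - σd j t) - 1)))
      ≤ U * Real.exp (-(b0 * ε)) := by
    apply mul_le_mul hw1.2 _ (Real.exp_pos _).le hU.le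
    apply Real.exp_le_exp.2
    have := mul_le_mul hbl (show ε ≤ w (t - σd j t) - 1 by linarith) hε.le
      (by linarith [hN.hb0])
    linarith
  have hP := hN.Ppos t htT j
  nlinarith

lemma lower (hN : NF m P b τd σd w Φ T0 τ B b0 C) {U V c ε D T1 : ℝ} (hT1 : T0 ≤ T1)
    (hV0 : 0 < V) (hU1 : 1 ≤ U) (hw : ∀ t ≥ T1, V ≤ w t ∧ w t ≤ U)
    (hD : ∀ t ≥ T1, ∀ j, Φ t - Φ (t - σd j t) ≤ D) (hcV : V ≤ c) (hε : 0 < ε)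
    (h1 : c + (Real.exp D - 1) * (c - V * Real.exp (-(B * (U - 1)))) ≤ 1 - ε)
    (h2 : c < V * Real.exp (b0 * ε)) : ∀ᶠ t in atTop, c ≤ w t := by
  have hτ := hN.hτ
  have main : ∀ᶠ t in atTop, (fun t => - w t) t ≤ -c := by
    refine eventually_le_aux (f := fun t => - w t) (Φ := Φ) (T1 := T1 + 2 * τ) (sub_pos.2 h2)
      (fun t ht => (hN.wder t (by linarith)).neg) (fun t ht => hN.Φder t (by linarith))
      (fun t ht => hN.Qpos (by linarith)) ?_ hN.Φinf
    intro t ht hct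
    have hct : w t ≤ c := by simpa using hct
    have htT : t ≥ T0 := by linarith
    rw [Finset.mul_sum, ← Finset.sum_neg_distrib]
    apply Finset.sum_le_sum
    intro j _
    have hσ1 := hN.σl t htT j
    have hσ2 := hN.σu t htT j
    have hτ2 := hN.τu t htT j
    set A := V * Real.exp (-(B * (U - 1))) with hA
    have hAV : A ≤ V := by
      rw [hA]
      apply mul_le_of_le_one_right hV0.le
      apply Real.exp_le_one_iff.2
      have := mul_nonneg hN.Bpos.le (show 0 ≤ U - 1 by linarith)
      linarith
    have hcmp := hN.compare_ge (s := t - σd j t) (t := t) (A := A) (by linarith) (by linarith) (by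
      intro r hr i
      have hrT : r ≥ T0 := by linarith [hr.1]
      have ha := hN.τu r hrT i
      have hb := hN.σu r hrT i
      have hbu := hN.bu r hrT i
      have hbl := hN.bl r hrT i
      have hr1 := hr.1
      have hw1 := hw (r - τd i r) (by linarith)
      have hw2 := hw (r - σd i r) (by linarith)
      have hb0 := hN.hb0
      apply mul_le_mul hw1.1 _ (Real.exp_pos _).le (by linarith)
      apply Real.exp_le_exp.2
      nlinarith [mul_le_mul_of_nonneg_left hw2.2 (show 0 ≤ b i r by linarith),
        mul_le_mul_of_nonneg_right hbu (show 0 ≤ U - 1 by linarith)])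
    have hΔ := hD t (by linarith) j
    have hws : w (t - σd j t) ≤ 1 - ε := by
      have e1 : Real.exp (Φ t)
          = Real.exp (Φ t - Φ (t - σd j t)) * Real.exp (Φ (t - σd j t)) := by
        rw [← Real.exp_add]; ring_nf
      rw [e1, ← mul_assoc] at hcmp
      have h3 := le_of_mul_le_mul_right hcmp (Real.exp_pos _)
      have h4 := Real.exp_le_exp.2 hΔ
      have h5 := (hw t (by linarith)).1
      have h6 : (w t - A) * Real.exp (Φ t - Φ (t - σd j t)) ≤ (c - A) * Real.exp D :=
        mul_le_mul (by linarith) h4 (Real.exp_pos _).le (by linarith)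
      nlinarith
    have hbl := hN.bl t htT j
    have hw1 := hw (t - τd j t) (by linarith)
    have hF : V * Real.exp (b0 * ε)
        ≤ w (t - τd j t) * Real.exp (-(b j t * (w (t - σd j t) - 1))) := by
      apply mul_le_mul hw1.1 _ (Real.exp_pos _).le (by linarith)
      apply Real.exp_le_exp.2
      have := mul_le_mul hbl (show ε ≤ 1 - w (t - σd j t) by linarith) hε.le
        (by linarith [hN.hb0])
      linarith
    have hP := hN.Ppos t htT j
    nlinarith
  filter_upwards [main] with t ht
  simpa using ht

lemma bdd_below (hN : NF m P b τd σd w Φ T0 τ B b0 C) :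
    ∃ κ > 0, ∀ t ≥ T0 - τ, κ ≤ w t := by
  have hτ := hN.hτ
  obtain ⟨t0, ht0, hmin⟩ := (isCompact_Icc (a := T0 - τ) (b := T0 + τ)).exists_isMinOn
    ⟨T0, by constructor <;> linarith⟩ (hN.wc.mono (fun s hs => hs.1))
  refine ⟨min (Real.exp (-C)) (w t0), lt_min (Real.exp_pos _) (hN.wpos _ ht0.1), ?_⟩
  intro t' ht'
  by_contra hcon
  push Not at hcon
  obtain ⟨t, ht, htmin⟩ := (isCompact_Icc (a := T0 - τ) (b := t')).exists_isMinOn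
    ⟨t', right_mem_Icc.2 ht'⟩ (hN.wc.mono (fun s hs => hs.1))
  have hlt : w t < min (Real.exp (-C)) (w t0) :=
    lt_of_le_of_lt (htmin (right_mem_Icc.2 ht')) hcon
  have htbig : T0 + τ < t := by
    by_contra hc
    push Not at hc
    have := hmin (show t ∈ Icc (T0 - τ) (T0 + τ) from ⟨ht.1, hc⟩)
    exact absurd (lt_of_lt_of_le hlt (min_le_right _ _)) (not_lt.2 this)
  have hm1 : ∀ s, T0 - τ ≤ s → s ≤ t → w t ≤ w s := fun s h1 h2 => htmin ⟨h1, h2.trans ht.2⟩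
  have hd := deriv_nonneg_of_left_max (a := T0 - τ) (hN.wder t (by linarith)).neg (by linarith)
    (fun s hs => by simpa using hm1 s hs.1 hs.2)
  have hT : t ≥ T0 := by linarith
  have hex : ∃ j, w (t - σd j t) ≥ 1 := by
    by_contra hall
    push Not at hall
    have : Nonempty (Fin m) := ⟨⟨0, hN.hm⟩⟩
    have : 0 < ∑ j, P j t *
        (w (t - τd j t) * Real.exp (-(b j t * (w (t - σd j t) - 1))) - w t) := by
      apply Finset.sum_pos _ Finset.univ_nonempty
      intro j _
      apply mul_pos (hN.Ppos t hT j)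
      have h1 := hN.τl t hT j
      have h2 := hN.τu t hT j
      have h3 := hm1 (t - τd j t) (by linarith) (by linarith)
      have h4 : 1 < Real.exp (-(b j t * (w (t - σd j t) - 1))) := by
        apply Real.one_lt_exp_iff.2
        have := mul_pos (lt_of_lt_of_le hN.hb0 (hN.bl t hT j)) (sub_pos.2 (hall j))
        linarith
      have h5 := hN.wpos (t - τd j t) (by linarith)
      nlinarith
    linarith
  obtain ⟨j, hj⟩ := hex
  have h1 := hN.σl t hT j
  have h2 := hN.σu t hT j
  have h3 := hN.harnack (s := t - σd j t) (t := t) (by linarith) (by linarith)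
  have h4 : Φ t - Φ (t - σd j t) ≤ C := by
    have := hN.ΦC t (by linarith)
    have := hN.Φle (s := t - τ) (t := t - σd j t) (by linarith) (by linarith)
    linarith
  have h5 := Real.exp_le_exp.2 h4
  have h6 := lt_of_lt_of_le hlt (min_le_left _ _)
  rw [Real.exp_neg] at h6
  have h7 : w t * Real.exp C < 1 := by
    rwa [← one_div, lt_div_iff₀ (Real.exp_pos _)] at h6
  have h8 := mul_le_mul_of_nonneg_left h5 (hN.wpos t (by linarith)).le
  linarith

lemma bdd_above (hN : NF m P b τd σd w Φ T0 τ B b0 C) :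
    ∃ N, ∀ t ≥ T0 - τ, w t ≤ N := by
  have hτ := hN.hτ
  have hC0 : 0 ≤ C := by
    have h1 := hN.ΦC (T0 + τ) le_rfl
    have h2 := hN.Φle (s := T0 + τ - τ) (t := T0 + τ) (by linarith) (by linarith)
    linarith
  obtain ⟨t0, ht0, hmax⟩ := (isCompact_Icc (a := T0 - τ) (b := T0 + 2 * τ)).exists_isMaxOn
    ⟨T0, by constructor <;> linarith⟩ (hN.wc.mono (fun s hs => hs.1))
  set L := Real.exp B with hL
  have hLpos : 0 < L := Real.exp_pos _
  refine ⟨max (Real.exp C * Real.exp (L * C)) (w t0), ?_⟩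
  intro t' ht'
  by_contra hcon
  push Not at hcon
  obtain ⟨t, ht, htmax⟩ := (isCompact_Icc (a := T0 - τ) (b := t')).exists_isMaxOn
    ⟨t', right_mem_Icc.2 ht'⟩ (hN.wc.mono (fun s hs => hs.1))
  have hlt : max (Real.exp C * Real.exp (L * C)) (w t0) < w t :=
    lt_of_lt_of_le hcon (htmax (right_mem_Icc.2 ht'))
  have htbig : T0 + 2 * τ < t := by
    by_contra hc
    push Not at hc
    have := hmax (show t ∈ Icc (T0 - τ) (T0 + 2 * τ) from ⟨ht.1, hc⟩)
    exact absurd (lt_of_le_of_lt (le_max_right _ _) hlt) (not_lt.2 this)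
  have hm1 : ∀ s, T0 - τ ≤ s → s ≤ t → w s ≤ w t := fun s h1 h2 => htmax ⟨h1, h2.trans ht.2⟩
  have hd := deriv_nonneg_of_left_max (a := T0 - τ) (hN.wder t (by linarith)) (by linarith)
    (fun s hs => hm1 s hs.1 hs.2)
  have hT : t ≥ T0 := by linarith
  have : Nonempty (Fin m) := ⟨⟨0, hN.hm⟩⟩
  have hex : ∃ j, w (t - σd j t) ≤ 1 := by
    by_contra hall
    push Not at hall
    have : ∑ j, P j t *
        (w (t - τd j t) * Real.exp (-(b j t * (w (t - σd j t) - 1))) - w t) < 0 := by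
      apply Finset.sum_neg _ Finset.univ_nonempty
      intro j _
      apply mul_neg_of_pos_of_neg (hN.Ppos t hT j)
      have h1 := hN.τl t hT j
      have h2 := hN.τu t hT j
      have h3 := hm1 (t - τd j t) (by linarith) (by linarith)
      have h4 : Real.exp (-(b j t * (w (t - σd j t) - 1))) < 1 := by
        apply Real.exp_lt_one_iff.2
        have := mul_pos (lt_of_lt_of_le hN.hb0 (hN.bl t hT j)) (sub_pos.2 (hall j))
        linarith
      have h5 := hN.wpos (t - τd j t) (by linarith)
      nlinarith
    linarith
  obtain ⟨j, hj⟩ := hex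
  have h1 := hN.σl t hT j
  have h2 := hN.σu t hT j
  set s0 := t - σd j t with hs0
  -- bound on the window before `s0`
  have hpre : ∀ r, s0 - τ ≤ r → r ≤ s0 → w r ≤ Real.exp C := by
    intro r hr1 hr2
    have h3 := hN.harnack (s := r) (t := s0) (by linarith) hr2
    have h4 := hN.ΦC s0 (by linarith)
    have h5 := hN.Φle (s := s0 - τ) (t := r) (by linarith) hr1
    have h6 := Real.exp_le_exp.2 (show Φ s0 - Φ r ≤ C by linarith)
    have h7 := hN.wpos s0 (by linarith)
    have h8 := Real.exp_pos (Φ s0 - Φ r)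
    nlinarith
  have hder : ∀ r ≥ T0, HasDerivAt (fun r => w r * Real.exp (-(L * (Φ r - Φ s0))))
      (Real.exp (-(L * (Φ r - Φ s0))) * ∑ i, P i r *
        (w (r - τd i r) * Real.exp (-(b i r * (w (r - σd i r) - 1))) - w r - L * w r)) r := by
    intro r hr
    have h1 := (hN.wder r hr).mul ((((hN.Φder r hr).sub_const (Φ s0)).const_mul L).neg).exp
    refine h1.congr_deriv ?_
    simp only [Pi.neg_apply]
    simp only [mul_sub, Finset.sum_sub_distrib, ← Finset.sum_mul]
    ring
  obtain ⟨r, hr, hrmax⟩ := (isCompact_Icc (a := s0) (b := t)).exists_isMaxOn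
    ⟨t, right_mem_Icc.2 (by linarith)⟩ (f := fun r => w r * Real.exp (-(L * (Φ r - Φ s0))))
    (fun r hr => (hder r (by linarith [hr.1])).continuousAt.continuousWithinAt)
  have hrT : r ≥ T0 := by linarith [hr.1]
  have hwr := hN.wpos r (by linarith)
  have hwrC : w r ≤ Real.exp C := by
    rcases eq_or_lt_of_le hr.1 with h | h
    · rw [← h]; exact hpre s0 (by linarith) le_rfl
    · have hd2 := deriv_nonneg_of_left_max (a := s0) (hder r hrT) h
        (fun s hs => hrmax ⟨hs.1, hs.2.trans hr.2⟩)
      have hex2 : ∃ i, w r ≤ w (r - τd i r) ∧ r - τd i r < s0 := by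
        by_contra hall
        push Not at hall
        have : ∑ i, P i r *
            (w (r - τd i r) * Real.exp (-(b i r * (w (r - σd i r) - 1))) - w r - L * w r)
            < 0 := by
          apply Finset.sum_neg _ Finset.univ_nonempty
          intro i _
          apply mul_neg_of_pos_of_neg (hN.Ppos r hrT i)
          have g1 := hN.τl r hrT i
          have g2 := hN.τu r hrT i
          have g3 := hN.σu r hrT i
          have hr1 := hr.1
          have g4 : w (r - τd i r) ≤ w r := by
            by_contra hc
            push Not at hc
            have g5 := hall i hc.le
            have g6 := hrmax (show r - τd i r ∈ Icc s0 t from ⟨g5, by linarith [hr.2]⟩)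
            simp only [mem_ofPred_eq] at g6
            have g7 := hN.Φle (s := r - τd i r) (t := r) (by linarith) (by linarith)
            have g8 : Real.exp (-(L * (Φ r - Φ s0)))
                ≤ Real.exp (-(L * (Φ (r - τd i r) - Φ s0))) := by
              apply Real.exp_le_exp.2
              nlinarith
            have g9 := Real.exp_pos (-(L * (Φ r - Φ s0)))
            nlinarith
          have g5 : Real.exp (-(b i r * (w (r - σd i r) - 1))) ≤ L := by
            apply Real.exp_le_exp.2
            have := hN.bu r hrT i
            have := mul_pos (lt_of_lt_of_le hN.hb0 (hN.bl r hrT i))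
              (hN.wpos (r - σd i r) (by linarith))
            linarith
          have g6 := hN.wpos (r - τd i r) (by linarith)
          have g7 := mul_le_mul g4 g5 (Real.exp_pos _).le hwr.le
          linarith
        have := mul_neg_of_pos_of_neg (Real.exp_pos (-(L * (Φ r - Φ s0)))) this
        linarith
      obtain ⟨i, hi1, hi2⟩ := hex2
      have g2 := hN.τu r hrT i
      exact hi1.trans (hpre _ (by linarith) hi2.le)
  have hfin := hrmax (show t ∈ Icc s0 t from ⟨by linarith, le_rfl⟩)
  simp only [mem_ofPred_eq] at hfin
  have k1 : Φ t - Φ s0 ≤ C := by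
    have := hN.ΦC t (by linarith)
    have := hN.Φle (s := t - τ) (t := s0) (by linarith) (by linarith)
    linarith
  have k2 : Real.exp (-(L * (Φ r - Φ s0))) ≤ 1 := by
    apply Real.exp_le_one_iff.2
    have := hN.Φle (s := s0) (t := r) (by linarith) hr.1
    nlinarith
  have k3 : Real.exp (-(L * C)) ≤ Real.exp (-(L * (Φ t - Φ s0))) := by
    apply Real.exp_le_exp.2
    nlinarith
  have k4 : w t * Real.exp (-(L * C)) ≤ Real.exp C := by
    have q1 := mul_le_mul_of_nonneg_left k3 (hN.wpos t (by linarith)).le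
    have q2 := mul_le_mul_of_nonneg_left k2 hwr.le
    linarith
  have k5 : w t ≤ Real.exp C * Real.exp (L * C) := by
    rw [Real.exp_neg, ← div_eq_mul_inv, div_le_iff₀ (Real.exp_pos _)] at k4
    exact k4
  exact absurd (lt_of_le_of_lt (le_max_left _ _) hlt) (not_lt.2 k5)

end NF

lemma exp_tanh_ineq {x : ℝ} (hx : 0 < x) : Real.exp x * (2 - x) < 2 + x := by
  have hd : ∀ y, HasDerivAt (fun y : ℝ => 2 + y - Real.exp y * (2 - y))
      (1 - Real.exp y * (1 - y)) y := by
    intro y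
    have h := ((hasDerivAt_id y).const_add 2).sub
      ((Real.hasDerivAt_exp y).mul ((hasDerivAt_id y).const_sub 2))
    refine h.congr_deriv ?_
    simp only [id]
    ring
  have hmono : StrictMonoOn (fun y : ℝ => 2 + y - Real.exp y * (2 - y)) (Ici 0) := by
    apply strictMonoOn_of_deriv_pos (convex_Ici 0)
    · intro y _
      exact (hd y).continuousAt.continuousWithinAt
    · intro y hy
      rw [interior_Ici] at hy
      rw [(hd y).deriv]
      have h1 := Real.add_one_lt_exp (x := -y) (by
        have : (0:ℝ) < y := hy
        linarith)
      have h2 := mul_lt_mul_of_pos_left h1 (Real.exp_pos y)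
      rw [← Real.exp_add, add_neg_cancel, Real.exp_zero] at h2
      have h3 : -y + 1 = 1 - y := by ring
      rw [h3] at h2
      linarith
  have h := hmono (self_mem_Ici : (0:ℝ) ∈ Ici 0) (show x ∈ Ici (0:ℝ) from hx.le) hx
  simp only [Real.exp_zero] at h
  linarith

lemma transcend {X Y k : ℝ} (hX : 0 ≤ X) (hY : 0 ≤ Y) (hk : 0 ≤ k)
    (h1 : X ≤ (Real.exp Y - 1) * (1 + k * X))
    (h2 : Y * (1 + k * (1 - Real.exp (-X))) ≤ 1 - Real.exp (-X)) : X = 0 ∧ Y = 0 := by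
  rcases eq_or_lt_of_le hX with hX0 | hX0
  · refine ⟨hX0.symm, ?_⟩
    rw [← hX0] at h2
    simp at h2
    linarith
  rcases eq_or_lt_of_le hY with hY0 | hY0
  · exfalso
    rw [← hY0] at h1
    simp at h1
    linarith
  exfalso
  have hz : 0 < Real.exp Y - 1 := by
    have := Real.one_lt_exp_iff.2 hY0
    linarith
  have hq : 0 < 1 - Real.exp (-X) := by
    have := Real.exp_lt_one_iff.2 (show -X < 0 by linarith)
    linarith
  have e1 := exp_tanh_ineq hY0
  have e2 := exp_tanh_ineq hX0
  have e3 : (1 - Real.exp (-X)) * (2 + X) < 2 * X := by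
    have := mul_lt_mul_of_pos_left e2 (Real.exp_pos (-X))
    rw [← mul_assoc, ← Real.exp_add, neg_add_cancel, Real.exp_zero] at this
    linarith
  set z := Real.exp Y - 1 with hzd
  set q := 1 - Real.exp (-X) with hqd
  have f1 : 1 / Y < 1 / z + 1 / 2 := by
    have : 1 / z + 1 / 2 - 1 / Y = (2 * Y - z * (2 - Y)) / (2 * z * Y) := by
      field_simp
      ring
    have h3 : 0 < (2 * Y - z * (2 - Y)) / (2 * z * Y) := by
      apply div_pos _ (by positivity)
      rw [hzd]; linarith
    linarith
  have f2 : 1 / X + 1 / 2 < 1 / q := by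
    have : 1 / q - (1 / X + 1 / 2) = (2 * X - q * (2 + X)) / (2 * q * X) := by
      field_simp
    have h3 : 0 < (2 * X - q * (2 + X)) / (2 * q * X) := div_pos (by linarith) (by positivity)
    linarith
  have f3 : 1 / z ≤ 1 / X + k := by
    have : 1 / X + k - 1 / z = (z * (1 + k * X) - X) / (z * X) := by
      field_simp
    have h3 : 0 ≤ (z * (1 + k * X) - X) / (z * X) := div_nonneg (by linarith) (by positivity)
    linarith
  have f4 : 1 / q + k ≤ 1 / Y := by
    have : 1 / Y - (1 / q + k) = (q - Y * (1 + k * q)) / (q * Y) := by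
      field_simp
    have h3 : 0 ≤ (q - Y * (1 + k * q)) / (q * Y) := div_nonneg (by linarith) (by positivity)
    linarith
  linarith

lemma eventually_small {F : ℝ → ℝ} (hF : Continuous F) (h : 0 < F 0) :
    ∀ᶠ η in nhdsWithin (0:ℝ) (Ioi 0), 0 < F η :=
  (hF.continuousAt.eventually (lt_mem_nhds h)).filter_mono nhdsWithin_le_nhds

namespace NF

variable {m : ℕ} {P b τd σd : Fin m → ℝ → ℝ} {w Φ : ℝ → ℝ} {T0 τ B b0 C : ℝ}

theorem tendsto_one (hN : NF m P b τd σd w Φ T0 τ B b0 C) {K : ℝ} (hK : 0 < K)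
    (hBK : B * (K - 1) ≤ 1)
    (hσ : ∀ η > 0, ∀ᶠ t in atTop, ∀ j, Φ t - Φ (t - σd j t) ≤ Real.log K + η) :
    Tendsto w atTop (nhds 1) := by
  have hτ := hN.hτ
  have hB := hN.Bpos
  obtain ⟨κ, hκ, hκw⟩ := hN.bdd_below
  obtain ⟨N, hNw⟩ := hN.bdd_above
  have hK1 : 1 ≤ K := by
    by_contra hc
    push Not at hc
    have hlog := Real.log_neg hK hc
    obtain ⟨t, ht1, ht2⟩ := ((hσ (-Real.log K / 2) (by linarith)).and
      (eventually_ge_atTop (T0 + τ))).exists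
    have h1 := ht1 ⟨0, hN.hm⟩
    have h2 := hN.σl t (by linarith) ⟨0, hN.hm⟩
    have h3 := hN.σu t (by linarith) ⟨0, hN.hm⟩
    have h4 := hN.Φle (s := t - σd ⟨0, hN.hm⟩ t) (t := t) (by linarith) (by linarith)
    linarith
  have evb : ∀ᶠ t in atTop, κ ≤ w t ∧ w t ≤ N := by
    filter_upwards [eventually_ge_atTop (T0 - τ)] with t ht
    exact ⟨hκw t ht, hNw t ht⟩
  have bu : IsBoundedUnder (· ≤ ·) atTop w := ⟨N, by simpa using evb.mono fun t h => h.2⟩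
  have bl : IsBoundedUnder (· ≥ ·) atTop w := ⟨κ, by simpa using evb.mono fun t h => h.1⟩
  set u := limsup w atTop with hu
  set v := liminf w atTop with hv
  have hvκ : κ ≤ v := le_liminf_of_le bu.isCoboundedUnder_ge (evb.mono fun t h => h.1)
  have evu : ∀ y, u < y → ∀ᶠ t in atTop, w t < y := fun y hy => eventually_lt_of_limsup_lt hy bu
  have evv : ∀ y, y < v → ∀ᶠ t in atTop, y < w t := fun y hy => eventually_lt_of_lt_liminf hy bl
  set u' := max u 1 with hu'
  set v' := min v 1 with hv'
  have hu1 : 1 ≤ u' := le_max_right _ _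
  have huu : u ≤ u' := le_max_left _ _
  have hv1 : v' ≤ 1 := min_le_right _ _
  have hvv : v' ≤ v := min_le_left _ _
  have hv0 : 0 < v' := lt_min (lt_of_lt_of_le hκ hvκ) one_pos
  have hpick : ∀ η > 0, ∃ T1 ≥ T0, (∀ t ≥ T1, v' - η ≤ w t ∧ w t ≤ u' + η) ∧
      ∀ t ≥ T1, ∀ j, Φ t - Φ (t - σd j t) ≤ Real.log K + η := by
    intro η hη
    obtain ⟨T1, hT1⟩ := eventually_atTop.1 ((((evu (u' + η) (by linarith)).and
      (evv (v' - η) (by linarith))).and (hσ η hη)).and (eventually_ge_atTop T0))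
    exact ⟨T1, (hT1 T1 le_rfl).2, fun t ht => ⟨(hT1 t ht).1.1.2.le, (hT1 t ht).1.1.1.le⟩,
      fun t ht => (hT1 t ht).1.2⟩
  have hr1 : 1 ≤ Real.exp (B * (1 - v')) :=
    Real.one_le_exp (mul_nonneg hB.le (by linarith))
  have hs1 : Real.exp (-(B * (u' - 1))) ≤ 1 :=
    Real.exp_le_one_iff.2 (by
      have := mul_nonneg hB.le (show 0 ≤ u' - 1 by linarith)
      linarith)
  have I1 : u' - 1 ≤ (K - 1) * u' * (Real.exp (B * (1 - v')) - 1) := by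
    by_contra hc
    push Not at hc
    have hpos : 0 ≤ (K - 1) * u' * (Real.exp (B * (1 - v')) - 1) :=
      mul_nonneg (mul_nonneg (by linarith) (by linarith)) (by linarith)
    have hu1' : 1 < u' := by linarith
    have hueq : u' = u := by
      rcases max_choice u 1 with h | h
      · exact h
      · rw [← hu'] at h; linarith
    obtain ⟨ε, hε, hgap⟩ : ∃ ε > 0,
        1 + ε < u' - (K - 1) * u' * (Real.exp (B * (1 - v')) - 1) :=
      ⟨(u' - 1 - (K - 1) * u' * (Real.exp (B * (1 - v')) - 1)) / 2, by linarith, by linarith⟩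
    have E1 := eventually_small (F := fun η => (u' - η) - (Real.exp (Real.log K + η) - 1) *
      ((u' + η) * Real.exp (B * (1 - (v' - η))) - (u' - η)) - (1 + ε)) (by fun_prop) (by
        simp only [sub_zero, add_zero, Real.exp_log hK]
        linarith)
    have E2 := eventually_small (F := fun η => (u' - η) - (u' + η) * Real.exp (-(b0 * ε)))
      (by fun_prop) (by
        simp only [sub_zero, add_zero]
        have := Real.exp_lt_one_iff.2 (show -(b0 * ε) < 0 by
          have := mul_pos hN.hb0 hε
          linarith)
        nlinarith)
    obtain ⟨η, ⟨hE1, hE2⟩, hη⟩ := ((E1.and E2).and self_mem_nhdsWithin).exists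
    have hη : 0 < η := hη
    obtain ⟨T1, hT1, hw, hD⟩ := hpick η hη
    have := hN.upper hT1 (by linarith) hw hD (c := u' - η) (by linarith) hε (by linarith)
      (by linarith)
    have h2 : u ≤ u' - η := limsup_le_of_le bl.isCoboundedUnder_le this
    linarith
  have I2 : 1 - v' ≤ (K - 1) * v' * (1 - Real.exp (-(B * (u' - 1)))) := by
    by_contra hc
    push Not at hc
    have hpos : 0 ≤ (K - 1) * v' * (1 - Real.exp (-(B * (u' - 1)))) :=
      mul_nonneg (mul_nonneg (by linarith) (by linarith)) (by linarith)
    have hv1' : v' < 1 := by linarith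
    have hveq : v' = v := by
      rcases min_choice v 1 with h | h
      · exact h
      · rw [← hv'] at h; linarith
    obtain ⟨ε, hε, hgap⟩ : ∃ ε > 0,
        v' + (K - 1) * v' * (1 - Real.exp (-(B * (u' - 1)))) < 1 - ε :=
      ⟨(1 - v' - (K - 1) * v' * (1 - Real.exp (-(B * (u' - 1))))) / 2, by linarith, by linarith⟩
    have E1 := eventually_small (F := fun η => 1 - ε - ((v' + η) +
      (Real.exp (Real.log K + η) - 1) *
      ((v' + η) - (v' - η) * Real.exp (-(B * (u' + η - 1)))))) (by fun_prop) (by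
        simp only [sub_zero, add_zero, Real.exp_log hK]
        linarith)
    have E2 := eventually_small (F := fun η => (v' - η) * Real.exp (b0 * ε) - (v' + η))
      (by fun_prop) (by
        simp only [sub_zero, add_zero]
        have := Real.one_lt_exp_iff.2 (mul_pos hN.hb0 hε)
        nlinarith)
    have E3 := eventually_small (F := fun η => v' - η) (by fun_prop) (by simpa using hv0)
    obtain ⟨η, ⟨⟨hE1, hE2⟩, hE3⟩, hη⟩ := (((E1.and E2).and E3).and self_mem_nhdsWithin).exists
    have hη : 0 < η := hη
    obtain ⟨T1, hT1, hw, hD⟩ := hpick η hη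
    have := hN.lower hT1 hE3 (by linarith) hw hD (c := v' + η) (by linarith) hε (by linarith)
      (by linarith)
    have h2 : v' + η ≤ v := le_liminf_of_le bu.isCoboundedUnder_ge this
    linarith
  have hfin := transcend (X := B * (u' - 1)) (Y := B * (1 - v')) (k := K - 1)
    (mul_nonneg hB.le (by linarith)) (mul_nonneg hB.le (by linarith)) (by linarith) (by
      have h1 := mul_le_mul_of_nonneg_left I1 hB.le
      have h2 := mul_le_mul_of_nonneg_right hBK
        (show 0 ≤ Real.exp (B * (1 - v')) - 1 by linarith)
      nlinarith) (by
      have h1 := mul_le_mul_of_nonneg_left I2 hB.le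
      have h2 := mul_le_mul_of_nonneg_right hBK
        (show 0 ≤ 1 - Real.exp (-(B * (u' - 1))) by linarith)
      nlinarith)
  have hu2 : u ≤ 1 := by
    have := (mul_eq_zero.1 hfin.1).resolve_left hB.ne'
    linarith
  have hv2 : 1 ≤ v := by
    have := (mul_eq_zero.1 hfin.2).resolve_left hB.ne'
    linarith
  rw [tendsto_order]
  exact ⟨fun y hy => evv y (by linarith), fun y hy => evu y (by linarith)⟩

end NF

/-- The coefficient `δ`, extended continuously to the whole line. -/
def extδ (δ : ℝ → ℝ) (t : ℝ) : ℝ := δ (max t 0)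

/-- The primitive of the extended coefficient. -/
def primδ (δ : ℝ → ℝ) (t : ℝ) : ℝ := ∫ s in (0:ℝ)..t, extδ δ s

lemma extδ_eq {δ : ℝ → ℝ} {t : ℝ} (ht : 0 ≤ t) : extδ δ t = δ t := by
  simp [extδ, max_eq_left ht]

lemma extδ_cont {δ : ℝ → ℝ} (h : ContinuousOn δ (Ici 0)) : Continuous (extδ δ) :=
  h.comp_continuous (by fun_prop) (fun t => le_max_right t 0)

lemma primδ_der {δ : ℝ → ℝ} (h : ContinuousOn δ (Ici 0)) (t : ℝ) :
    HasDerivAt (primδ δ) (extδ δ t) t :=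
  intervalIntegral.integral_hasDerivAt_right ((extδ_cont h).intervalIntegrable _ _)
    (extδ_cont h).stronglyMeasurable.stronglyMeasurableAtFilter (extδ_cont h).continuousAt

lemma primδ_sub {δ : ℝ → ℝ} (h : ContinuousOn δ (Ici 0)) {s t : ℝ} (hs : 0 ≤ s) (ht : 0 ≤ t) :
    primδ δ t - primδ δ s = ∫ r in s..t, δ r := by
  unfold primδ
  rw [intervalIntegral.integral_interval_sub_left ((extδ_cont h).intervalIntegrable _ _)
    ((extδ_cont h).intervalIntegrable _ _)]
  apply intervalIntegral.integral_congr
  intro r hr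
  exact extδ_eq (le_trans (le_min hs ht) hr.1)

lemma primδ_mono {δ : ℝ → ℝ} (h : ContinuousOn δ (Ici 0)) (hp : ∀ t ≥ (0:ℝ), 0 < δ t) :
    Monotone (primδ δ) := by
  apply monotone_of_deriv_nonneg (fun t => (primδ_der h t).differentiableAt)
  intro t
  rw [(primδ_der h t).deriv]
  exact (hp _ (le_max_right t 0)).le

lemma delay_bounds {m : ℕ} {p a : Fin m → ℝ → ℝ} {δ : ℝ → ℝ} {τd σd : Fin m → ℝ → ℝ} {τ : ℝ}
    (hA0 : HypA0 m p a δ τd σd) (hτ : IsMaxDelay m τd σd τ) :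
    ∀ t ≥ (0:ℝ), ∀ j, 0 ≤ τd j t ∧ τd j t ≤ τ ∧ 0 ≤ σd j t ∧ σd j t ≤ τ := by
  intro t ht j
  obtain ⟨-, -, -, h4⟩ := hA0
  have h := (h4 j).2.2.1 t ht
  exact ⟨h.1, hτ.1 ⟨j, t, ht, Or.inl rfl⟩, h.2, hτ.1 ⟨j, t, ht, Or.inr rfl⟩⟩

lemma IsPosSol.der {m : ℕ} {p a : Fin m → ℝ → ℝ} {δ : ℝ → ℝ} {τd σd : Fin m → ℝ → ℝ} {τ : ℝ}
    {x : ℝ → ℝ} (hx : IsPosSol m p a δ τd σd τ x) {t : ℝ} (ht : 0 < t) :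
    HasDerivAt x ((∑ j, p j t * x (t - τd j t) * Real.exp (-(a j t * x (t - σd j t))))
      - δ t * x t) t :=
  (hx.2.2.2 t ht.le).hasDerivAt (Ici_mem_nhds ht)

lemma IsPosSol.pos {m : ℕ} {p a : Fin m → ℝ → ℝ} {δ : ℝ → ℝ} {τd σd : Fin m → ℝ → ℝ} {τ : ℝ}
    (hm : 0 < m) (hA0 : HypA0 m p a δ τd σd) (hτ : IsMaxDelay m τd σd τ)
    {x : ℝ → ℝ} (hx : IsPosSol m p a δ τd σd τ x) : ∀ t ≥ (0:ℝ), 0 < x t := by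
  intro t1 ht1
  by_contra hc
  push Not at hc
  have hdb := delay_bounds hA0 hτ
  have hδc := hA0.2.2.1.1
  have hτ0 : 0 ≤ τ := (hdb 0 le_rfl ⟨0, hm⟩).1.trans (hdb 0 le_rfl ⟨0, hm⟩).2.1
  have hcont : ContinuousOn x (Icc 0 t1) := hx.1.mono (fun s hs => by
    have := hs.1
    show -τ ≤ s
    linarith)
  have hcl : IsClosed (Icc 0 t1 ∩ x ⁻¹' Iic 0) :=
    hcont.preimage_isClosed_of_isClosed isClosed_Icc isClosed_Iic
  have hcomp : IsCompact (Icc 0 t1 ∩ x ⁻¹' Iic 0) :=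
    isCompact_Icc.of_isClosed_subset hcl inter_subset_left
  obtain ⟨t2, ht2, hleast⟩ := hcomp.exists_isLeast ⟨t1, ⟨ht1, le_rfl⟩, hc⟩
  have hx2 : x t2 ≤ 0 := ht2.2
  have hlt : ∀ s, 0 ≤ s → s < t2 → 0 < x s := by
    intro s hs hst
    by_contra hcs
    push Not at hcs
    have := hleast ⟨⟨hs, hst.le.trans ht2.1.2⟩, hcs⟩
    linarith
  have hnn : ∀ s, -τ ≤ s → s < t2 → 0 ≤ x s := by
    intro s hs hst
    rcases lt_or_ge s 0 with h | h
    · exact hx.2.1 s ⟨hs, h⟩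
    · exact (hlt s h hst).le
  have hd : ∀ t > 0, HasDerivAt (fun t => x t * Real.exp (primδ δ t))
      ((∑ j, p j t * x (t - τd j t) * Real.exp (-(a j t * x (t - σd j t))))
        * Real.exp (primδ δ t)) t := by
    intro t ht
    refine ((hx.der ht).mul (primδ_der hδc t).exp).congr_deriv ?_
    rw [extδ_eq ht.le]
    ring
  have hmono : MonotoneOn (fun t => x t * Real.exp (primδ δ t)) (Icc 0 t2) := by
    apply monotoneOn_of_deriv_nonneg (convex_Icc 0 t2)
    · apply (hcont.mono (Icc_subset_Icc_right ht2.1.2)).mul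
      intro t _
      exact (primδ_der hδc t).exp.continuousAt.continuousWithinAt
    · intro t ht
      rw [interior_Icc] at ht
      exact (hd t ht.1).differentiableAt.differentiableWithinAt
    · intro t ht
      rw [interior_Icc] at ht
      rw [(hd t ht.1).deriv]
      apply mul_nonneg _ (Real.exp_pos _).le
      apply Finset.sum_nonneg
      intro j _
      have h1 := hdb t ht.1.le j
      have ht1 := ht.1
      have ht2 := ht.2
      exact mul_nonneg (mul_nonneg ((hA0.1 j).2 t ht.1.le).le
        (hnn _ (by linarith) (by linarith))) (Real.exp_pos _).le
  have h := hmono (left_mem_Icc.2 ht2.1.1) (right_mem_Icc.2 ht2.1.1) ht2.1.1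
  simp only at h
  have h1 := mul_pos hx.2.2.1 (Real.exp_pos (primδ δ 0))
  have h2 := mul_nonpos_of_nonpos_of_nonneg hx2 (Real.exp_pos (primδ δ t2)).le
  linarith

lemma int_δ_bound {m : ℕ} {p a : Fin m → ℝ → ℝ} {δ : ℝ → ℝ} {τd σd : Fin m → ℝ → ℝ} {τ : ℝ}
    (hA0 : HypA0 m p a δ τd σd) (hτ0 : 0 ≤ τ)
    (hA1 : HypA1 m p δ) (hA2 : HypA2 m p τ) :
    ∃ C1, ∀ᶠ t in atTop, primδ δ t - primδ δ (t - τ) ≤ C1 := by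
  obtain ⟨hp, -, ⟨hδc, hδp⟩, -⟩ := hA0
  have hbd : IsBoundedUnder (· ≥ ·) atTop (fun t => (∑ j, p j t) / δ t) := by
    refine ⟨0, ?_⟩
    simp only [eventually_map]
    filter_upwards [eventually_ge_atTop 0] with t ht
    exact div_nonneg (Finset.sum_nonneg fun j _ => ((hp j).2 t ht).le) (hδp t ht).le
  have h1 := eventually_lt_of_lt_liminf hA1.1 hbd
  obtain ⟨C1, hC1⟩ := hA2
  simp only [eventually_map] at hC1
  obtain ⟨T2, hT2⟩ := eventually_atTop.1 (h1.and (eventually_ge_atTop (0:ℝ)))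
  refine ⟨C1, ?_⟩
  filter_upwards [hC1, eventually_ge_atTop (T2 + τ)] with t ht htT
  have hT20 : 0 ≤ T2 := (hT2 T2 le_rfl).2
  rw [primδ_sub hδc (by linarith) (by linarith)]
  refine le_trans ?_ ht
  have hsub : uIcc (t - τ) t ⊆ Ici 0 := by
    rw [uIcc_of_le (by linarith)]
    intro s hs
    have := hs.1
    show 0 ≤ s
    linarith
  apply intervalIntegral.integral_mono_on (by linarith)
  · exact (hδc.mono hsub).intervalIntegrable
  · apply ContinuousOn.intervalIntegrable
    exact continuousOn_finsetSum _ (fun j _ => (hp j).1.mono hsub)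
  · intro s hs
    have h3 := hT2 s (by linarith [hs.1])
    have h4 := h3.1
    rw [lt_div_iff₀ (hδp s h3.2)] at h4
    linarith

lemma low_a {m : ℕ} {p a : Fin m → ℝ → ℝ} {δ : ℝ → ℝ} {τd σd : Fin m → ℝ → ℝ}
    (hm : 0 < m) (hA0 : HypA0 m p a δ τd σd) : ∃ c0 > 0, ∀ t ≥ (0:ℝ), ∀ j, c0 ≤ a j t := by
  have : Nonempty (Fin m) := ⟨⟨0, hm⟩⟩
  choose c C hc using fun j => (hA0.2.1 j).2
  refine ⟨Finset.univ.inf' Finset.univ_nonempty c, ?_, ?_⟩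
  · rw [gt_iff_lt, Finset.lt_inf'_iff]
    exact fun j _ => (hc j).1
  · intro t ht j
    exact (Finset.inf'_le c (Finset.mem_univ j)).trans ((hc j).2 t ht).1

theorem global_attractivity_of_fixed_solution
    (m : ℕ) (hm : 0 < m) (p a : Fin m → ℝ → ℝ) (δ : ℝ → ℝ)
    (τd σd : Fin m → ℝ → ℝ) (τ : ℝ)
    (hA0 : HypA0 m p a δ τd σd) (hτ : IsMaxDelay m τd σd τ)
    (hA1 : HypA1 m p δ) (hA2 : HypA2 m p τ) (hA3 : HypA3 δ)
    (aplus : ℝ)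
    (haplus : IsLUB {r : ℝ | ∃ j : Fin m, ∃ t : ℝ, 0 ≤ t ∧ r = a j t} aplus)
    (ζplus : ℝ)
    (hζ : IsGreatest {r : ℝ | ∃ j : Fin m,
        r = Filter.limsup (fun t => ∫ s in (t - σd j t)..t, δ s) Filter.atTop} ζplus)
    (xstar : ℝ → ℝ) (hxstar : IsPosSol m p a δ τd σd τ xstar)
    (mstar Mstar T : ℝ) (hmstar : 0 < mstar) (hMstar : 0 < Mstar) (hT : 0 < T)
    (hbounds : ∀ t ≥ T - τ, mstar ≤ xstar t ∧ xstar t ≤ Mstar)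
    (hA4 : aplus * Mstar * ((Mstar / mstar) * Real.exp ζplus - 1) ≤ 1) :
    ∀ x : ℝ → ℝ, IsPosSol m p a δ τd σd τ x →
      Filter.Tendsto (fun t => x t - xstar t) Filter.atTop (nhds 0) := by
  intro x hx
  have hdb := delay_bounds hA0 hτ
  have hτ0 : 0 ≤ τ := (hdb 0 le_rfl ⟨0, hm⟩).1.trans (hdb 0 le_rfl ⟨0, hm⟩).2.1
  have hδc := hA0.2.2.1.1
  have hδp := hA0.2.2.1.2
  have hDmono := primδ_mono hδc hδp
  have hxpos := hx.pos hm hA0 hτ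
  obtain ⟨c0, hc0, hc0a⟩ := low_a hm hA0
  obtain ⟨C1, hC1⟩ := int_δ_bound hA0 hτ0 hA1 hA2
  obtain ⟨TC, hTC⟩ := eventually_atTop.1 hC1
  have hsp : ∀ t ≥ T - τ, 0 < xstar t := fun t ht => lt_of_lt_of_le hmstar (hbounds t ht).1
  have hlogl : ∀ t ≥ T - τ, Real.log mstar ≤ Real.log (xstar t) := fun t ht =>
    Real.log_le_log hmstar (hbounds t ht).1
  have hlogu : ∀ t ≥ T - τ, Real.log (xstar t) ≤ Real.log Mstar := fun t ht =>
    Real.log_le_log (hsp t ht) (hbounds t ht).2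
  set T0 := max T TC + τ with hT0
  have hT0T : T ≤ T0 - τ := by rw [hT0]; linarith [le_max_left T TC]
  have hT0C : TC ≤ T0 := by rw [hT0]; linarith [le_max_right T TC]
  have hN : NF m (fun j t => p j t * xstar (t - τd j t) / xstar t *
        Real.exp (-(a j t * xstar (t - σd j t))))
      (fun j t => a j t * xstar (t - σd j t)) τd σd (fun t => x t / xstar t)
      (fun t => Real.log (xstar t) + primδ δ t) T0 τ (aplus * Mstar) (c0 * mstar)
      (Real.log Mstar - Real.log mstar + C1) := by
    refine ⟨hm, hτ0, mul_pos hc0 hmstar, ?_, ?_, ?_, ?_, ?_, ?_, ?_, ?_, ?_, ?_, ?_, ?_, ?_⟩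
    · have hsub : Ici (T0 - τ) ⊆ Ici (-τ) := Ici_subset_Ici.2 (by linarith)
      exact (hx.1.mono hsub).div (hxstar.1.mono hsub)
        (fun t ht => (hsp t (by have : T0 - τ ≤ t := ht; linarith)).ne')
    · intro t ht
      exact div_pos (hxpos t (by linarith)) (hsp t (by linarith))
    · intro t ht
      have hs := hsp t (by linarith)
      refine ((hx.der (by linarith)).div (hxstar.der (by linarith)) hs.ne').congr_deriv ?_
      rw [div_eq_iff (by positivity), sub_mul, mul_sub, Finset.sum_mul, Finset.mul_sum,
        Finset.sum_mul]
      have e : ∀ A B D E : ℝ, A - D * x t * xstar t - (B - x t * (E * xstar t))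
          = A - B + (E - D) * (x t * xstar t) := by intros; ring
      rw [e, sub_self, zero_mul, add_zero, ← Finset.sum_sub_distrib]
      apply Finset.sum_congr rfl
      intro j _
      have hb := hdb t (by linarith) j
      have hs1 := hsp (t - τd j t) (by linarith)
      have hs2 := hsp (t - σd j t) (by linarith)
      have e2 : Real.exp (-(a j t * x (t - σd j t))) =
          Real.exp (-(a j t * xstar (t - σd j t))) *
          Real.exp (-(a j t * xstar (t - σd j t) *
            (x (t - σd j t) / xstar (t - σd j t) - 1))) := by
        rw [← Real.exp_add]
        congr 1
        field_simp
        ring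
      rw [e2]
      field_simp
    · intro t ht
      have hs := hsp t (by linarith)
      refine (((hxstar.der (by linarith)).log hs.ne').add (primδ_der hδc t)).congr_deriv ?_
      rw [extδ_eq (by linarith), sub_div, mul_div_cancel_right₀ _ hs.ne', sub_add_cancel,
        Finset.sum_div]
      apply Finset.sum_congr rfl
      intro j _
      ring
    · intro t ht j
      have hb := hdb t (by linarith) j
      have h1 := (hA0.1 j).2 t (by linarith)
      have h2 := hsp t (by linarith)
      have h3 := hsp (t - τd j t) (by linarith)
      positivity
    · intro t ht j
      have hb := hdb t (by linarith) j
      exact mul_le_mul (hc0a t (by linarith) j) (hbounds _ (by linarith)).1 hmstar.le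
        (hc0.le.trans (hc0a t (by linarith) j))
    · intro t ht j
      have hb := hdb t (by linarith) j
      have ha : a j t ≤ aplus := haplus.1 ⟨j, t, by linarith, rfl⟩
      have ha0 := hc0a t (by linarith) j
      exact mul_le_mul ha (hbounds _ (by linarith)).2 (hsp _ (by linarith)).le (by linarith)
    · exact fun t ht j => (hdb t (by linarith) j).1
    · exact fun t ht j => (hdb t (by linarith) j).2.1
    · exact fun t ht j => (hdb t (by linarith) j).2.2.1
    · exact fun t ht j => (hdb t (by linarith) j).2.2.2
    · intro t ht
      have h1 := hTC t (by linarith)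
      have h2 := hlogu t (by linarith)
      have h3 := hlogl (t - τ) (by linarith)
      linarith
    · apply tendsto_atTop_add_left_of_le' _ (Real.log mstar)
      · filter_upwards [eventually_ge_atTop (T - τ)] with t ht using hlogl t ht
      · refine hA3.congr' ?_
        filter_upwards [eventually_ge_atTop 0] with t ht
        have := primδ_sub hδc le_rfl ht
        rw [← this]
        simp [primδ]
  have hlim := hN.tendsto_one (K := Mstar / mstar * Real.exp ζplus) (by positivity) hA4 (by
    intro η hη
    rw [Real.log_mul (by positivity) (Real.exp_pos _).ne', Real.log_exp,
      Real.log_div hMstar.ne' hmstar.ne']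
    rw [eventually_all]
    intro j
    have hb1 : ∀ᶠ t in atTop, (∫ s in (t - σd j t)..t, δ s) ≤ C1 := by
      filter_upwards [eventually_ge_atTop T0] with t ht
      have hb := hdb t (by linarith) j
      rw [← primδ_sub hδc (by linarith) (by linarith)]
      have h1 := hTC t (by linarith)
      have h2 := hDmono (show t - τ ≤ t - σd j t by linarith)
      linarith
    have hev := eventually_lt_of_limsup_lt
      (lt_of_le_of_lt (hζ.2 ⟨j, rfl⟩) (show ζplus < ζplus + η by linarith)) ⟨C1, hb1⟩
    filter_upwards [hev, eventually_ge_atTop T0] with t h1 ht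
    have hb := hdb t (by linarith) j
    rw [← primδ_sub hδc (by linarith) (by linarith)] at h1
    have h2 := hlogu t (by linarith)
    have h3 := hlogl (t - σd j t) (by linarith)
    linarith)
  have hz : Tendsto (fun t => Mstar * |x t / xstar t - 1|) atTop (nhds 0) := by
    have := ((hlim.sub_const 1).abs).const_mul Mstar
    simpa using this
  refine squeeze_zero_norm' ?_ hz
  filter_upwards [eventually_ge_atTop T0] with t ht
  have hs := hsp t (by linarith)
  have hu := (hbounds t (by linarith)).2
  have e : x t - xstar t = xstar t * (x t / xstar t - 1) := by
    field_simp
  rw [e, norm_mul, Real.norm_eq_abs, Real.norm_eq_abs, abs_of_pos hs]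
  exact mul_le_mul_of_nonneg_right hu (abs_nonneg _)
end
end

section
/- Consider equation (**) with p := ∑_{j=1}^m p_j > δ and hypotheses (H0), (H1), (H2), and assume (H3): a⁺K(e^{δζ⁺} − 1) ≤ 1, where a⁺ = max_j a_j, ζ⁺ = max_{1≤j≤m} limsup_{t→∞} ∫_{t−σ_j(t)}^t β(s) ds, and K > 0 is defined by ∑_{j=1}^m p_j e^{−a_j K} = δ. Then K is globally attractive: every positive solution x of (**) satisfies lim_{t→∞} x(t) = K. In particular, this conclusion holds if (a⁺/a⁻)(e^{δζ⁺} − 1) log(p/δ) ≤ 1, where a⁻ = min_j a_j. -/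
open Real Filter MeasureTheory Set

noncomputable section

/-- A positive (admissible) solution of the Nicholson equation (**)
`x'(t) = β(t) (-δ x(t) + ∑ j, p j * x (t - τd j t) * exp (-(a j * x (t - σd j t))))`,
considered for `t ≥ 0`, with nonnegative continuous initial data on `[-τ, 0)` and `x 0 > 0`. -/
def IsPosSolB (m : ℕ) (β : ℝ → ℝ) (δ : ℝ) (p a : Fin m → ℝ)
    (τd σd : Fin m → ℝ → ℝ) (τ : ℝ) (x : ℝ → ℝ) : Prop :=
  ContinuousOn x (Ici (-τ)) ∧
  (∀ θ ∈ Ico (-τ) (0:ℝ), 0 ≤ x θ) ∧ 0 < x 0 ∧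
  ∀ t ≥ (0:ℝ), HasDerivWithinAt x
      (β t * (-(δ * x t) +
        ∑ j, p j * x (t - τd j t) * Real.exp (-(a j * x (t - σd j t)))))
      (Ici 0) t

/-- Hypothesis (H0): `δ, p j, a j` are positive constants, `β` is continuous and positive
on `[0,∞)`, and the delays are continuous, nonnegative and bounded. -/
def HypH0 (m : ℕ) (β : ℝ → ℝ) (δ : ℝ) (p a : Fin m → ℝ)
    (τd σd : Fin m → ℝ → ℝ) : Prop :=
  0 < δ ∧ (∀ j, 0 < p j) ∧ (∀ j, 0 < a j) ∧
  (ContinuousOn β (Ici 0) ∧ ∀ t ≥ (0:ℝ), 0 < β t) ∧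
  (∀ j, ContinuousOn (τd j) (Ici 0) ∧ ContinuousOn (σd j) (Ici 0) ∧
      (∀ t ≥ (0:ℝ), 0 ≤ τd j t ∧ 0 ≤ σd j t) ∧
      ∃ B : ℝ, ∀ t ≥ (0:ℝ), τd j t ≤ B ∧ σd j t ≤ B)

/-- `τ = max_j max (sup_t τd j t, sup_t σd j t)`: the supremum of all the delays. -/
def IsMaxDelayB (m : ℕ) (τd σd : Fin m → ℝ → ℝ) (τ : ℝ) : Prop :=
  IsLUB {r : ℝ | ∃ j : Fin m, ∃ t : ℝ, 0 ≤ t ∧ (r = τd j t ∨ r = σd j t)} τ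

/-- Hypothesis (H1): `∫_0^∞ β(s) ds = ∞`. -/
def HypH1 (β : ℝ → ℝ) : Prop :=
  Filter.Tendsto (fun t => ∫ s in (0:ℝ)..t, β s) Filter.atTop Filter.atTop



lemma nich_exp_bound {z : ℝ} (hz : 0 < z) : 1 - exp (-z) < 2 * z / (2 + z) := by
  have h1 : 1 - 2 * z / (2 + z) = (2 - z) / (2 + z) := by field_simp; ring
  suffices h : (2 - z) / (2 + z) < exp (-z) by linarith
  rw [div_lt_iff₀ (by linarith)]
  rcases le_or_gt 2 z with h2 | h2
  · have := mul_pos (exp_pos (-z)) (by linarith : 0 < 2 + z)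
    linarith
  · have hB : (0:ℝ) ≤ 2 * z / (4 - z) := div_nonneg (by linarith) (by linarith)
    have hl := Real.le_log_one_add_of_nonneg hB
    have h4 : (0:ℝ) < 4 - z := by linarith
    have e1 : 2 * (2 * z / (4 - z)) / (2 * z / (4 - z) + 2) = z / 2 := by
      field_simp; ring
    have e2 : 1 + 2 * z / (4 - z) = (4 + z) / (4 - z) := by field_simp; ring
    rw [e1, e2] at hl
    have h5 : exp (z / 2) ≤ (4 + z) / (4 - z) := by
      rw [← Real.le_log_iff_exp_le (by positivity)]; exact hl
    have h6 : (4 - z) / (4 + z) ≤ exp (-(z / 2)) := by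
      rw [Real.exp_neg, ← inv_div]
      exact inv_anti₀ (exp_pos _) h5
    have h7 : exp (-z) = exp (-(z / 2)) ^ 2 := by rw [← Real.exp_nat_mul]; congr 1; push_cast; ring
    have h8 : ((4 - z) / (4 + z)) ^ 2 ≤ exp (-z) := by
      rw [h7]; gcongr
    have h9 : 2 - z < ((4 - z) / (4 + z)) ^ 2 * (2 + z) := by
      rw [div_pow, div_mul_eq_mul_div, lt_div_iff₀ (by positivity)]
      nlinarith [pow_pos hz 3]
    nlinarith

lemma nich_alg {l K L A θ : ℝ} (hl : 0 < l) (hlK : l ≤ K) (hKL : K ≤ L) (hA : 0 < A)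
    (hH : θ * (A * K) ≤ 1)
    (h1 : L * (1 - θ * (exp (A * (K - l)) - 1)) ≤ K)
    (h2 : K ≤ l * (1 + θ * (1 - exp (-(A * (L - K)))))) : L = K ∧ l = K := by
  have hK : 0 < K := by linarith
  set k := A * K with hk
  have hkp : 0 < k := by positivity
  obtain ⟨z, hz⟩ : ∃ z, z = A * (L - K) := ⟨_, rfl⟩
  obtain ⟨u, hu⟩ : ∃ u, u = A * (K - l) := ⟨_, rfl⟩
  have hz0 : 0 ≤ z := by rw [hz]; exact mul_nonneg hA.le (by linarith)
  have hu0 : 0 ≤ u := by rw [hu]; exact mul_nonneg hA.le (by linarith)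
  have hAL : A * L = k + z := by rw [hz, hk]; ring
  have hAl : A * l = k - u := by rw [hu, hk]; ring
  have huk : u < k := by have := mul_pos hA hl; linarith
  rw [← hu] at h1
  rw [← hz] at h2
  have h1' : (k + z) * (1 - θ * (exp u - 1)) ≤ k := by
    rw [← hAL, hk, mul_assoc]; exact mul_le_mul_of_nonneg_left h1 hA.le
  have h2' : k ≤ (k - u) * (1 + θ * (1 - exp (-z))) := by
    rw [← hAl, hk, mul_assoc]; exact mul_le_mul_of_nonneg_left h2 hA.le
  have hθk : θ ≤ 1 / k := by rw [le_div_iff₀ hkp]; exact hH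
  have hE : 0 ≤ exp u - 1 := by have := Real.add_one_le_exp u; linarith
  have hD : 0 ≤ 1 - exp (-z) := by
    have : exp (-z) ≤ 1 := Real.exp_le_one_iff.2 (by linarith)
    linarith
  have h1'' : (k + z) * (1 - 1 / k * (exp u - 1)) ≤ k := by
    refine le_trans ?_ h1'
    gcongr
  have h2'' : k ≤ (k - u) * (1 + 1 / k * (1 - exp (-z))) := by
    refine le_trans h2' ?_
    have : 0 ≤ k - u := by linarith
    gcongr
  have hz' : z = 0 := by
    by_contra hne
    have hzp : 0 < z := lt_of_le_of_ne hz0 (Ne.symm hne)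
    have hD2 := nich_exp_bound hzp
    have e1 : 1 + k * z / (k + z) ≤ exp u := by
      have : k * z / (k + z) ≤ exp u - 1 := by
        rw [div_le_iff₀ (by positivity)]
        have e : (k + z) * (1 - 1 / k * (exp u - 1)) * k = (k + z) * (k - (exp u - 1)) := by
          field_simp
        have := mul_le_mul_of_nonneg_right h1'' hkp.le
        rw [e] at this
        nlinarith
      linarith
    have hB : 0 ≤ k * z / (k + z) := by positivity
    have e2 := Real.le_log_one_add_of_nonneg hB
    have e3 : log (1 + k * z / (k + z)) ≤ u := by
      rw [Real.log_le_iff_le_exp (by positivity)]; exact e1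
    have e4 : 2 * (k * z / (k + z)) / (k * z / (k + z) + 2) = 2 * k * z / (k * z + 2 * (k + z)) := by
      field_simp
    have e5 : 2 * k * z / (k * z + 2 * (k + z)) ≤ u := by linarith
    rw [div_le_iff₀ (by positivity)] at e5
    have e6 : k < (k - u) * (1 + 1 / k * (2 * z / (2 + z))) := by
      refine lt_of_le_of_lt h2'' ?_
      have : 0 < k - u := by linarith
      gcongr
    have e7 : (k - u) * (1 + 1 / k * (2 * z / (2 + z))) * (k * (2 + z))
        = (k - u) * (k * (2 + z) + 2 * z) := by field_simp
    have e8 := mul_lt_mul_of_pos_right e6 (by positivity : 0 < k * (2 + z))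
    rw [e7] at e8
    nlinarith
  have hu' : u = 0 := by
    rw [hz'] at h2''
    simp at h2''
    linarith
  constructor
  · rw [hz'] at hz
    have := hz.symm
    rw [mul_eq_zero] at this
    rcases this with h | h <;> linarith
  · rw [hu'] at hu
    have := hu.symm
    rw [mul_eq_zero] at this
    rcases this with h | h <;> linarith

/-- Right-hand side delayed production term. -/
noncomputable def nichF (m : ℕ) (p a : Fin m → ℝ) (τd σd : Fin m → ℝ → ℝ) (x : ℝ → ℝ) (t : ℝ) : ℝ :=
  ∑ j, p j * x (t - τd j t) * Real.exp (-(a j * x (t - σd j t)))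

noncomputable def nichG (m : ℕ) (p a : Fin m → ℝ) (z : ℝ) : ℝ := ∑ j, p j * Real.exp (-(a j * z))

structure NichCore (m : ℕ) (δ : ℝ) (p a : Fin m → ℝ) (τd σd : Fin m → ℝ → ℝ) (τ : ℝ)
    (b B x : ℝ → ℝ) (C T : ℝ) : Prop where
  hm : 0 < m
  hδ : 0 < δ
  hp : ∀ j, 0 < p j
  ha : ∀ j, 0 < a j
  τ0 : 0 ≤ τ
  hτ : ∀ j, ∀ t, 0 ≤ t → 0 ≤ τd j t ∧ τd j t ≤ τ
  hσ : ∀ j, ∀ t, 0 ≤ t → 0 ≤ σd j t ∧ σd j t ≤ τ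
  bpos : ∀ t, 0 < b t
  Bd : ∀ t, HasDerivAt B (b t) t
  Btop : Tendsto B atTop atTop
  xc : ContinuousOn x (Ici (-τ))
  xn : ∀ θ ∈ Ico (-τ) (0:ℝ), 0 ≤ x θ
  x0 : 0 < x 0
  xd : ∀ t, 0 < t → HasDerivAt x (b t * (-(δ * x t) + nichF m p a τd σd x t)) t
  Tτ : τ ≤ T
  hC : ∀ t, T ≤ t → B t - B (t - τ) ≤ C

lemma nich_first {x : ℝ → ℝ} {a c : ℝ} (hx : ContinuousOn x (Ici a)) (ha : c < x a)
    (h : ∃ t, a ≤ t ∧ x t ≤ c) : ∃ t, a < t ∧ x t ≤ c ∧ ∀ s, a ≤ s → s < t → c < x s := by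
  set S : Set ℝ := {t | t ∈ Ici a ∧ x t ≤ c} with hS
  have hcl : IsClosed S := by
    have := hx.preimage_isClosed_of_isClosed isClosed_Ici (isClosed_Iic (a := c))
    exact this
  have hne : S.Nonempty := by obtain ⟨t, h1, h2⟩ := h; exact ⟨t, h1, h2⟩
  have hbd : BddBelow S := ⟨a, fun t ht => ht.1⟩
  have hmem := hcl.csInf_mem hne hbd
  refine ⟨sInf S, ?_, hmem.2, ?_⟩
  · rcases lt_or_eq_of_le (show a ≤ sInf S from hmem.1) with h | h
    · exact h
    · have := hmem.2
      rw [← h] at this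
      linarith
  · intro s h1 h2
    by_contra h3
    have : sInf S ≤ s := csInf_le hbd ⟨h1, not_lt.1 h3⟩
    linarith

lemma nich_gron {b B y g : ℝ → ℝ} {κ s t : ℝ} (hb : ∀ t, 0 < b t)
    (hB : ∀ t, HasDerivAt B (b t) t) (hst : s ≤ t) (hc : ContinuousOn y (Icc s t))
    (hd : ∀ r ∈ Ioo s t, HasDerivAt y (b r * g r) r)
    (hg : ∀ r ∈ Ioo s t, g r ≤ -κ * y r) : exp (κ * (B t - B s)) * y t ≤ y s := by
  have hBc : Continuous B := continuous_iff_continuousAt.2 fun t => (hB t).continuousAt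
  have hder : ∀ r ∈ Ioo s t, HasDerivAt (fun r => exp (κ * (B r - B s)) * y r)
      (exp (κ * (B r - B s)) * (κ * b r) * y r + exp (κ * (B r - B s)) * (b r * g r)) r := by
    intro r hr
    have h1 : HasDerivAt (fun r => κ * (B r - B s)) (κ * b r) r :=
      ((hB r).sub_const (B s)).const_mul κ
    exact h1.exp.mul (hd r hr)
  have hanti : AntitoneOn (fun r => exp (κ * (B r - B s)) * y r) (Icc s t) := by
    apply antitoneOn_of_deriv_nonpos (convex_Icc s t)
    · apply ContinuousOn.mul _ hc
      fun_prop
    · rw [interior_Icc]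
      intro r hr
      exact (hder r hr).differentiableAt.differentiableWithinAt
    · rw [interior_Icc]
      intro r hr
      rw [(hder r hr).deriv]
      have h1 := hg r hr
      have h2 : 0 < exp (κ * (B r - B s)) * b r := mul_pos (exp_pos _) (hb r)
      have : exp (κ * (B r - B s)) * (κ * b r) * y r + exp (κ * (B r - B s)) * (b r * g r)
        = exp (κ * (B r - B s)) * b r * (g r - -κ * y r) := by ring
      rw [this]
      exact mul_nonpos_of_nonneg_of_nonpos h2.le (by linarith)
  have := hanti (left_mem_Icc.2 hst) (right_mem_Icc.2 hst) hst
  simpa using this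

/-- Fluctuation lemma. -/
lemma nich_fluct {b B y g : ℝ → ℝ} {c η : ℝ} (hb : ∀ t, 0 < b t)
    (hB : ∀ t, HasDerivAt B (b t) t) (hBtop : Tendsto B atTop atTop)
    (hd : ∀ r, 0 < r → HasDerivAt y (b r * g r) r) (hη : 0 < η)
    (h : ∀ᶠ t in atTop, c ≤ y t → g t ≤ -η) : ∀ᶠ t in atTop, y t ≤ c := by
  obtain ⟨T0, hT0⟩ := eventually_atTop.1 h
  set T := max T0 1 with hT
  have hTpos : 0 < T := lt_of_lt_of_le one_pos (le_max_right _ _)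
  have hg : ∀ t, T ≤ t → c ≤ y t → g t ≤ -η := fun t ht => hT0 t (le_trans (le_max_left _ _) ht)
  have hyc : ∀ u v, 0 < u → ContinuousOn y (Icc u v) := fun u v hu r hr =>
    (hd r (lt_of_lt_of_le hu hr.1)).continuousAt.continuousWithinAt
  have hex : ∃ t1, T ≤ t1 ∧ y t1 ≤ c := by
    by_contra hcon
    push Not at hcon
    have hder : ∀ r, T ≤ r → HasDerivAt (fun r => y r + η * B r) (b r * g r + η * b r) r :=
      fun r hr => (hd r (by linarith)).add ((hB r).const_mul η)
    have hanti : AntitoneOn (fun r => y r + η * B r) (Ici T) := by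
      apply antitoneOn_of_deriv_nonpos (convex_Ici T)
      · intro r hr
        exact (hder r hr).continuousAt.continuousWithinAt
      · intro r hr
        exact (hder r (interior_subset hr)).differentiableAt.differentiableWithinAt
      · intro r hr
        have hr' : T ≤ r := interior_subset hr
        rw [(hder r hr').deriv]
        have := hg r hr' (hcon r hr').le
        nlinarith [hb r]
    obtain ⟨t, ht1, ht2⟩ := ((hBtop.eventually_gt_atTop ((y T + η * B T - c) / η)).and
      (eventually_ge_atTop T)).exists
    have h1 := hanti self_mem_Ici ht2 ht2
    simp only at h1
    rw [div_lt_iff₀ hη] at ht1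
    have := hcon t ht2
    linarith
  obtain ⟨t1, ht1, hy1⟩ := hex
  filter_upwards [eventually_ge_atTop t1] with t ht
  have ht1p : 0 < t1 := by linarith
  refine image_le_of_deriv_right_lt_deriv_boundary' (f := y) (f' := fun r => b r * g r)
    (B := fun _ => c) (B' := fun _ => 0) (hyc t1 t ht1p) ?_ hy1 continuousOn_const ?_ ?_
    (right_mem_Icc.2 ht)
  · intro r hr
    exact (hd r (lt_of_lt_of_le ht1p hr.1)).hasDerivWithinAt
  · intro r hr
    exact hasDerivWithinAt_const _ _ _
  · intro r hr hrc
    have := hg r (le_trans ht1 hr.1) hrc.ge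
    nlinarith [hb r]

section
variable {m : ℕ} {δ : ℝ} {p a : Fin m → ℝ} {τd σd : Fin m → ℝ → ℝ} {τ : ℝ}
  {b B x : ℝ → ℝ} {C T : ℝ}

lemma nichG_cont : Continuous (nichG m p a) := by unfold nichG; fun_prop

lemma nichG_anti (hp : ∀ j, 0 < p j) (ha : ∀ j, 0 < a j) : Antitone (nichG m p a) := by
  intro u v huv
  unfold nichG
  refine Finset.sum_le_sum fun j _ => ?_
  have := hp j
  have := ha j
  gcongr

lemma nichG_santi (hm : 0 < m) (hp : ∀ j, 0 < p j) (ha : ∀ j, 0 < a j) :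
    StrictAnti (nichG m p a) := by
  intro u v huv
  unfold nichG
  refine Finset.sum_lt_sum_of_nonempty ⟨⟨0, hm⟩, Finset.mem_univ _⟩ fun j _ => ?_
  have := hp j
  have := ha j
  gcongr

lemma nichG_pos (hm : 0 < m) (hp : ∀ j, 0 < p j) (z : ℝ) : 0 < nichG m p a z := by
  unfold nichG
  refine Finset.sum_pos (fun j _ => mul_pos (hp j) (exp_pos _)) ⟨⟨0, hm⟩, Finset.mem_univ _⟩

lemma nichF_le (hp : ∀ j, 0 < p j) (ha : ∀ j, 0 < a j) {t lo hi : ℝ} (hi0 : 0 ≤ hi)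
    (h1 : ∀ j, x (t - τd j t) ≤ hi) (h2 : ∀ j, lo ≤ x (t - σd j t)) :
    nichF m p a τd σd x t ≤ hi * nichG m p a lo := by
  unfold nichF nichG
  rw [Finset.mul_sum]
  refine Finset.sum_le_sum fun j _ => ?_
  have hpj := hp j
  have haj := ha j
  calc p j * x (t - τd j t) * exp (-(a j * x (t - σd j t)))
      ≤ p j * hi * exp (-(a j * lo)) := by
        have := h1 j
        have := h2 j
        gcongr
    _ = _ := by ring

lemma nichF_ge (hp : ∀ j, 0 < p j) (ha : ∀ j, 0 < a j) {t lo hi : ℝ} (lo0 : 0 ≤ lo)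
    (h1 : ∀ j, lo ≤ x (t - τd j t)) (h2 : ∀ j, x (t - σd j t) ≤ hi) :
    lo * nichG m p a hi ≤ nichF m p a τd σd x t := by
  unfold nichF nichG
  rw [Finset.mul_sum]
  refine Finset.sum_le_sum fun j _ => ?_
  have hpj := hp j
  have haj := ha j
  calc lo * (p j * exp (-(a j * hi)))
      = p j * lo * exp (-(a j * hi)) := by ring
    _ ≤ p j * x (t - τd j t) * exp (-(a j * x (t - σd j t))) := by
        have := h1 j
        have := h2 j
        have : 0 ≤ p j * x (t - τd j t) := mul_nonneg hpj.le (by linarith)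
        gcongr

namespace NichCore

lemma Bmono (h : NichCore m δ p a τd σd τ b B x C T) : Monotone B := monotone_of_deriv_nonneg
  (fun t => (h.Bd t).differentiableAt) (fun t => by rw [(h.Bd t).deriv]; exact (h.bpos t).le)

lemma F_nonneg (h : NichCore m δ p a τd σd τ b B x C T) {t : ℝ} (ht : 0 ≤ t) (hx : ∀ s, -τ ≤ s → s ≤ t → 0 ≤ x s) :
    0 ≤ nichF m p a τd σd x t := by
  unfold nichF
  refine Finset.sum_nonneg fun j _ => ?_
  have := h.hτ j t ht
  have := hx (t - τd j t) (by linarith) (by linarith)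
  have := h.hp j
  positivity

lemma xcont (h : NichCore m δ p a τd σd τ b B x C T) {s t : ℝ} (hs : 0 ≤ s) : ContinuousOn x (Icc s t) :=
  h.xc.mono fun r hr => by have := h.τ0; exact (by linarith [hr.1] : -τ ≤ r)

lemma decay_aux (h : NichCore m δ p a τd σd τ b B x C T) {s t : ℝ} (hs : 0 ≤ s) (hst : s ≤ t)
    (hx : ∀ r, -τ ≤ r → r < t → 0 ≤ x r) : x s ≤ exp (δ * (B t - B s)) * x t := by
  have := nich_gron (κ := δ) (y := fun r => -x r)
    (g := fun r => -(-(δ * x r) + nichF m p a τd σd x r)) h.bpos h.Bd hst (h.xcont hs).neg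
    (fun r hr => by
      have := (h.xd r (lt_of_le_of_lt hs hr.1)).neg
      rwa [← mul_neg] at this)
    (fun r hr => by
      have := h.F_nonneg (t := r) (hs.trans hr.1.le)
        (fun u h1 h2 => hx u h1 (lt_of_le_of_lt h2 hr.2))
      linarith)
  linarith

lemma pos (h : NichCore m δ p a τd σd τ b B x C T) {t : ℝ} (ht : 0 ≤ t) : 0 < x t := by
  by_contra hcon
  obtain ⟨t0, h1, h2, h3⟩ := nich_first (a := 0) (c := 0)
    (h.xc.mono fun r hr => by have := h.τ0; exact (by linarith [mem_Ici.1 hr] : -τ ≤ r)) h.x0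
    ⟨t, ht, not_lt.1 hcon⟩
  have := h.decay_aux le_rfl h1.le (fun r hr1 hr2 => by
    rcases lt_or_ge r 0 with h0 | h0
    · exact h.xn r ⟨hr1, h0⟩
    · exact (h3 r h0 hr2).le)
  have h4 := mul_nonpos_of_nonneg_of_nonpos (exp_pos (δ * (B t0 - B 0))).le h2
  linarith [h.x0]

lemma nonneg (h : NichCore m δ p a τd σd τ b B x C T) {t : ℝ} (ht : -τ ≤ t) : 0 ≤ x t := by
  rcases lt_or_ge t 0 with h0 | h0
  · exact h.xn t ⟨ht, h0⟩
  · exact (h.pos h0).le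

lemma decay (h : NichCore m δ p a τd σd τ b B x C T) {t d : ℝ} (ht : T ≤ t) (hd : 0 ≤ d) (hdτ : d ≤ τ) :
    x (t - d) ≤ exp (δ * C) * x t := by
  have hT := h.Tτ
  have hτ0 := h.τ0
  have h1 := h.decay_aux (s := t - d) (t := t) (by linarith) (by linarith)
    (fun r hr _ => h.nonneg hr)
  refine h1.trans ?_
  have h2 := h.hC t ht
  have h3 := h.Bmono (show t - τ ≤ t - d by linarith)
  have := h.hδ
  have := h.pos (t := t) (by linarith)
  gcongr
  linarith

lemma growth (h : NichCore m δ p a τd σd τ b B x C T) {t d : ℝ} (ht : T + τ ≤ t) (hd : 0 ≤ d) (hdτ : d ≤ τ) :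
    x t ≤ exp ((exp (δ * C) * nichG m p a 0) * C) * x (t - d) := by
  have hT := h.Tτ
  have hτ0 := h.τ0
  set P := exp (δ * C) * nichG m p a 0 with hP
  have hPpos : 0 < P := mul_pos (exp_pos _) (nichG_pos h.hm h.hp 0)
  have h1 := nich_gron (κ := -P) (y := x) (s := t - d) (t := t)
    (g := fun r => (-(δ * x r) + nichF m p a τd σd x r)) h.bpos h.Bd (by linarith)
    (h.xcont (by linarith)) (fun r hr => h.xd r (by linarith [hr.1]))
    (fun r hr => by
      have hr1 := hr.1
      have hr0 : 0 ≤ r := by linarith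
      have hxr := h.pos hr0
      have h2 := nichF_le (x := x) (τd := τd) (σd := σd) (t := r) (lo := 0)
        (hi := exp (δ * C) * x r) h.hp h.ha (by positivity)
        (fun j => h.decay (by linarith) (h.hτ j r hr0).1 (h.hτ j r hr0).2)
        (fun j => h.nonneg (by linarith [(h.hσ j r hr0).2]))
      have h3 : 0 < δ * x r := mul_pos h.hδ hxr
      have h4 : exp (δ * C) * x r * nichG m p a 0 = P * x r := by rw [hP]; ring
      linarith)
  have h2 := h.hC t (by linarith)
  have h3 := h.Bmono (show t - τ ≤ t - d by linarith)
  have h5 : x t = exp (P * (B t - B (t - d))) * (exp (-P * (B t - B (t - d))) * x t) := by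
    rw [← mul_assoc, ← Real.exp_add]; simp
  rw [h5]
  have := h.pos (t := t - d) (by linarith)
  calc _ ≤ exp (P * (B t - B (t - d))) * x (t - d) := by gcongr
    _ ≤ _ := by gcongr; linarith

lemma bdd_above (h : NichCore m δ p a τd σd τ b B x C T) : ∃ M, ∀ᶠ t in atTop, x t ≤ M := by
  set H := exp ((exp (δ * C) * nichG m p a 0) * C) with hH
  have hHpos : 0 < H := exp_pos _
  have hτ0 := h.τ0
  have hT := h.Tτ
  have hδ := h.hδ
  have hlim : Tendsto (fun z => exp (δ * C) * nichG m p a (z / H)) atTop (nhds 0) := by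
    have : Tendsto (fun z => nichG m p a (z / H)) atTop (nhds 0) := by
      unfold nichG
      rw [← Finset.sum_const_zero (s := (Finset.univ : Finset (Fin m)))]
      refine tendsto_finsetSum _ fun j _ => ?_
      rw [← mul_zero (p j)]
      refine Tendsto.const_mul _ ?_
      refine Real.tendsto_exp_neg_atTop_nhds_zero.comp ?_
      exact (tendsto_id.atTop_div_const hHpos).const_mul_atTop (h.ha j)
    simpa using this.const_mul (exp (δ * C))
  obtain ⟨M, hM1, hM2⟩ := ((hlim.eventually_lt_const (half_pos hδ)).and
    (eventually_ge_atTop (1:ℝ))).exists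
  refine ⟨M, nich_fluct (η := δ / 2) h.bpos h.Bd h.Btop h.xd (half_pos hδ) ?_⟩
  filter_upwards [eventually_ge_atTop (T + τ)] with t ht hMt
  have ht0 : 0 ≤ t := by linarith
  have hxt := h.pos ht0
  have h2 := nichF_le (x := x) (τd := τd) (σd := σd) (t := t) (lo := M / H)
        (hi := exp (δ * C) * x t) h.hp h.ha (by positivity)
        (fun j => h.decay (by linarith) (h.hτ j t ht0).1 (h.hτ j t ht0).2)
        (fun j => by
          rw [div_le_iff₀ hHpos, mul_comm]
          exact hMt.trans (h.growth ht (h.hσ j t ht0).1 (h.hσ j t ht0).2))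
  have h3 : nichF m p a τd σd x t ≤ x t * (δ / 2) := by
    refine h2.trans ?_
    have : exp (δ * C) * x t * nichG m p a (M / H) = x t * (exp (δ * C) * nichG m p a (M / H)) := by
      ring
    rw [this]
    exact mul_le_mul_of_nonneg_left hM1.le hxt.le
  nlinarith

lemma bdd_below (h : NichCore m δ p a τd σd τ b B x C T) (hpδ : δ < nichG m p a 0) : ∃ c, 0 < c ∧ ∀ᶠ t in atTop, c ≤ x t := by
  have hτ0 := h.τ0
  have hT := h.Tτ
  have hδ := h.hδ
  -- minimum on the compact interval
  obtain ⟨r0, hr0, hmin⟩ := (isCompact_Icc (a := T) (b := T + τ)).exists_isMinOn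
    (nonempty_Icc.2 (by linarith)) (h.xcont (by linarith))
  have hμ : 0 < x r0 := h.pos (by linarith [hr0.1])
  have hcont : Tendsto (fun c => nichG m p a (exp (δ * C) * c)) (nhdsWithin 0 (Ioi 0))
      (nhds (nichG m p a 0)) := by
    have : Continuous fun c => nichG m p a (exp (δ * C) * c) :=
      nichG_cont.comp (continuous_const.mul continuous_id)
    have := this.tendsto 0
    simp only [mul_zero] at this
    exact this.mono_left nhdsWithin_le_nhds
  obtain ⟨c, hc1, hc2, hc3⟩ := ((hcont.eventually_const_lt hpδ).and
    ((Ioo_mem_nhdsGT hμ : Ioo 0 (x r0) ∈ nhdsWithin (0:ℝ) (Ioi 0)))).exists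
  refine ⟨c, hc2, ?_⟩
  filter_upwards [eventually_ge_atTop T] with t ht
  by_contra hcon
  have hlo : ∀ r ∈ Icc T (T + τ), c < x r := fun r hr => lt_of_lt_of_le hc3 (hmin hr)
  obtain ⟨t0, h1, h2, h3⟩ := nich_first (a := T) (c := c)
    (h.xc.mono fun r hr => (by linarith [mem_Ici.1 hr] : -τ ≤ r))
    (hlo T (left_mem_Icc.2 (by linarith))) ⟨t, ht, (not_le.1 hcon).le⟩
  have h4 : T + τ < t0 := by
    by_contra h5
    have := hlo t0 ⟨h1.le, not_lt.1 h5⟩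
    linarith
  have ht0 : 0 < t0 := by linarith
  have hxt := h.pos ht0.le
  have hge : ∀ s, T ≤ s → s ≤ t0 → x t0 ≤ x s := by
    intro s hs1 hs2
    rcases lt_or_eq_of_le hs2 with h5 | h5
    · exact h2.trans (h3 s hs1 h5).le
    · rw [h5]
  have hF := nichF_ge (x := x) (τd := τd) (σd := σd) (t := t0) (lo := x t0)
    (hi := exp (δ * C) * c) h.hp h.ha hxt.le
    (fun j => hge _ (by linarith [(h.hτ j t0 ht0.le).2]) (by linarith [(h.hτ j t0 ht0.le).1]))
    (fun j => (h.decay h1.le (h.hσ j t0 ht0.le).1 (h.hσ j t0 ht0.le).2).trans (by gcongr))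
  have hder := (h.xd t0 ht0).hasDerivWithinAt (s := Iio t0)
  rw [hasDerivWithinAt_iff_tendsto_slope' (by simp)] at hder
  have hle : b t0 * (-(δ * x t0) + nichF m p a τd σd x t0) ≤ 0 := by
    refine le_of_tendsto hder ?_
    filter_upwards [Ioo_mem_nhdsLT h1] with s hs
    rw [slope_def_field]
    exact div_nonpos_of_nonneg_of_nonpos (by linarith [hge s hs.1.le hs.2.le]) (by linarith [hs.2])
  have hpos : 0 < -(δ * x t0) + nichF m p a τd σd x t0 := by nlinarith
  have := mul_pos (h.bpos t0) hpos
  linarith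

lemma past_upper (h : NichCore m δ p a τd σd τ b B x C T) {t d lo hi c : ℝ} (ht : T + 2 * τ ≤ t) (hd : 0 ≤ d) (hdτ : d ≤ τ)
    (hlo : ∀ s, t - 2 * τ ≤ s → lo ≤ x s) (hhi : ∀ s, t - 2 * τ ≤ s → x s ≤ hi)
    (hi0 : 0 ≤ hi) (hc : hi * nichG m p a lo = δ * c) :
    exp (δ * (B t - B (t - d))) * (x t - c) ≤ x (t - d) - c := by
  have hτ0 := h.τ0
  have hT := h.Tτ
  refine nich_gron (κ := δ) (y := fun r => x r - c) (s := t - d) (t := t)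
    (g := fun r => (-(δ * x r) + nichF m p a τd σd x r)) h.bpos h.Bd (by linarith)
    ((h.xcont (by linarith)).sub continuousOn_const)
    (fun r hr => (h.xd r (by linarith [hr.1])).sub_const c) ?_
  intro r hr
  have hr1 := hr.1
  have hr0 : 0 ≤ r := by linarith
  have := nichF_le (x := x) (τd := τd) (σd := σd) (t := r) (lo := lo) (hi := hi) h.hp h.ha hi0
    (fun j => hhi _ (by linarith [(h.hτ j r hr0).2]))
    (fun j => hlo _ (by linarith [(h.hσ j r hr0).2]))
  linarith

lemma past_lower (h : NichCore m δ p a τd σd τ b B x C T) {t d lo hi c : ℝ} (ht : T + 2 * τ ≤ t) (hd : 0 ≤ d) (hdτ : d ≤ τ)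
    (hlo : ∀ s, t - 2 * τ ≤ s → lo ≤ x s) (hhi : ∀ s, t - 2 * τ ≤ s → x s ≤ hi)
    (lo0 : 0 ≤ lo) (hc : lo * nichG m p a hi = δ * c) :
    exp (δ * (B t - B (t - d))) * (c - x t) ≤ c - x (t - d) := by
  have hτ0 := h.τ0
  have hT := h.Tτ
  refine nich_gron (κ := δ) (y := fun r => c - x r) (s := t - d) (t := t)
    (g := fun r => -(-(δ * x r) + nichF m p a τd σd x r)) h.bpos h.Bd (by linarith)
    (continuousOn_const.sub (h.xcont (by linarith)))
    (fun r hr => ?_) ?_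
  · have := (h.xd r (by linarith [hr.1])).const_sub c
    rwa [← mul_neg] at this
  intro r hr
  have hr1 := hr.1
  have hr0 : 0 ≤ r := by linarith
  have := nichF_ge (x := x) (τd := τd) (σd := σd) (t := r) (lo := lo) (hi := hi) h.hp h.ha lo0
    (fun j => hlo _ (by linarith [(h.hτ j r hr0).2]))
    (fun j => hhi _ (by linarith [(h.hσ j r hr0).2]))
  linarith

lemma ev_past {P : ℝ → Prop} (d : ℝ) (hP : ∀ᶠ t in atTop, P t) :
    ∀ᶠ t in atTop, ∀ s, t - d ≤ s → P s := by
  obtain ⟨S, hS⟩ := eventually_atTop.1 hP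
  filter_upwards [eventually_ge_atTop (S + d)] with t ht s hs
  exact hS s (by linarith)

lemma eps_lim {f g : ℝ → ℝ} (hf : Continuous f) (hg : Continuous g)
    (hfg : ∀ᶠ ε in nhdsWithin (0:ℝ) (Ioi 0), f ε ≤ g ε) : f 0 ≤ g 0 :=
  le_of_tendsto_of_tendsto ((hf.tendsto 0).mono_left nhdsWithin_le_nhds)
    ((hg.tendsto 0).mono_left nhdsWithin_le_nhds) hfg

theorem attract (h : NichCore m δ p a τd σd τ b B x C T) {K ζ A : ℝ} (hK : 0 < K) (hGK : nichG m p a K = δ) 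
    (hζ : ∀ ε, 0 < ε → ∀ᶠ t in atTop, ∀ j, B t - B (t - σd j t) ≤ ζ + ε)
    (hA : ∀ j, a j ≤ A) (hH : (exp (δ * ζ) - 1) * (A * K) ≤ 1) : Tendsto x atTop (nhds K) := by
  have hτ0 := h.τ0
  have hT := h.Tτ
  have hδ := h.hδ
  have hsa := nichG_santi h.hm h.hp h.ha
  have hanti := nichG_anti h.hp h.ha
  have hG0 : δ < nichG m p a 0 := by rw [← hGK]; exact hsa hK
  obtain ⟨M, hM⟩ := h.bdd_above
  obtain ⟨c0, hc0, hc⟩ := h.bdd_below hG0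
  have bA : IsBoundedUnder (· ≤ ·) atTop x := ⟨M, by simpa using hM⟩
  have bB : IsBoundedUnder (· ≥ ·) atTop x := ⟨c0, by simpa using hc⟩
  have cA : IsCoboundedUnder (· ≤ ·) atTop x := bB.isCoboundedUnder_le
  have cB : IsCoboundedUnder (· ≥ ·) atTop x := bA.isCoboundedUnder_ge
  obtain ⟨L, hL⟩ : ∃ L, L = limsup x atTop := ⟨_, rfl⟩
  obtain ⟨l, hl⟩ : ∃ l, l = liminf x atTop := ⟨_, rfl⟩
  have hl0 : 0 < l := lt_of_lt_of_le hc0 (by rw [hl]; exact le_liminf_of_le cB hc)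
  have hlL : l ≤ L := by rw [hl, hL]; exact liminf_le_limsup bA bB
  have hu : ∀ ε, 0 < ε → ∀ᶠ t in atTop, x t ≤ L + ε := fun ε hε =>
    (eventually_lt_of_limsup_lt (b := L + ε) (by rw [← hL]; linarith) bA).mono fun t ht => ht.le
  have hd : ∀ ε, 0 < ε → ∀ᶠ t in atTop, l - ε ≤ x t := fun ε hε =>
    (eventually_lt_of_lt_liminf (b := l - ε) (by rw [← hl]; linarith) bB).mono fun t ht => ht.le
  have hfu : ∀ ε, 0 < ε → ∃ᶠ t in atTop, L - ε ≤ x t ∧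
      -ε < -(δ * x t) + nichF m p a τd σd x t := by
    intro ε hε hcon
    have h1 := nich_fluct (c := L - ε) (η := ε) h.bpos h.Bd h.Btop h.xd hε
      (hcon.mono fun t ht h2 => by
        by_contra h3
        exact ht ⟨h2, not_le.1 h3⟩)
    have := limsup_le_of_le cA h1
    rw [← hL] at this
    linarith
  have hfl : ∀ ε, 0 < ε → ∃ᶠ t in atTop, x t ≤ l + ε ∧
      -(δ * x t) + nichF m p a τd σd x t < ε := by
    intro ε hε hcon
    have h1 := nich_fluct (c := -(l + ε)) (η := ε) (y := fun t => -x t)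
      (g := fun r => -(-(δ * x r) + nichF m p a τd σd x r)) h.bpos h.Bd h.Btop
      (fun r hr => by
        have := (h.xd r hr).neg
        rwa [← mul_neg] at this) hε
      (hcon.mono fun t ht h2 => by
        by_contra h3
        exact ht ⟨by linarith, by linarith⟩)
    have := le_liminf_of_le (a := l + ε) cB (h1.mono fun t ht => by linarith)
    rw [← hl] at this
    linarith
  have hpast : ∀ ε, 0 < ε → ∀ᶠ t in atTop, T + 2 * τ ≤ t ∧ (∀ s, t - 2 * τ ≤ s → l - ε ≤ x s) ∧
      (∀ s, t - 2 * τ ≤ s → x s ≤ L + ε) ∧ (∀ j, B t - B (t - σd j t) ≤ ζ + ε) := fun ε hε => by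
    filter_upwards [eventually_ge_atTop (T + 2 * τ), ev_past (2 * τ) (hd ε hε),
      ev_past (2 * τ) (hu ε hε), hζ ε hε] with t h1 h2 h3 h4
    exact ⟨h1, h2, h3, h4⟩
  have hGc : Continuous (nichG m p a) := nichG_cont
  -- first crude comparison
  have hlK : l ≤ K := by
    have h1 : δ * (L - 0) - 0 ≤ (L + 0) * nichG m p a (l - 0) := by
      refine eps_lim (f := fun ε => δ * (L - ε) - ε)
        (g := fun ε => (L + ε) * nichG m p a (l - ε)) (by fun_prop) (by fun_prop) ?_
      filter_upwards [self_mem_nhdsWithin] with ε hε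
      have hε : 0 < ε := hε
      obtain ⟨t, ⟨h1, h2⟩, h3, h4, h5, h6⟩ := ((hfu ε hε).and_eventually (hpast ε hε)).exists
      have ht0 : 0 ≤ t := by linarith
      have := nichF_le (x := x) (τd := τd) (σd := σd) (t := t) (lo := l - ε) (hi := L + ε)
        h.hp h.ha (by linarith)
        (fun j => h5 _ (by linarith [(h.hτ j t ht0).2]))
        (fun j => h4 _ (by linarith [(h.hσ j t ht0).2]))
      nlinarith
    simp only [sub_zero, add_zero] at h1
    rw [mul_comm] at h1
    have h2 := le_of_mul_le_mul_left h1 (by linarith)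
    rw [← hGK] at h2
    exact hsa.le_iff_ge.1 h2
  have hKL : K ≤ L := by
    have h1 : (l - 0) * nichG m p a (L + 0) ≤ δ * (l + 0) + 0 := by
      refine eps_lim (g := fun ε => δ * (l + ε) + ε)
        (f := fun ε => (l - ε) * nichG m p a (L + ε)) (by fun_prop) (by fun_prop) ?_
      filter_upwards [Ioo_mem_nhdsGT hl0] with ε hε'
      have hε : 0 < ε := hε'.1
      have hεl := hε'.2
      obtain ⟨t, ⟨h1, h2⟩, h3, h4, h5, h6⟩ := ((hfl ε hε).and_eventually (hpast ε hε)).exists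
      have ht0 : 0 ≤ t := by linarith
      have := nichF_ge (x := x) (τd := τd) (σd := σd) (t := t) (lo := l - ε) (hi := L + ε)
        h.hp h.ha (by linarith)
        (fun j => h4 _ (by linarith [(h.hτ j t ht0).2]))
        (fun j => h5 _ (by linarith [(h.hσ j t ht0).2]))
      nlinarith
    simp only [sub_zero, add_zero] at h1
    rw [mul_comm δ] at h1
    have h2 := le_of_mul_le_mul_left h1 (by linarith)
    rw [← hGK] at h2
    exact hsa.le_iff_ge.1 h2
  have hL0 : 0 < L := by linarith
  -- refined comparison, upper
  have hR : L * nichG m p a l / δ + exp (δ * ζ) * (L - L * nichG m p a l / δ) ≤ K := by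
    obtain ⟨R, hRdef⟩ : ∃ R : ℝ → ℝ, R = fun ε => (L + ε) * nichG m p a (l - ε) / δ +
      exp (δ * (ζ + ε)) * ((L - ε) - (L + ε) * nichG m p a (l - ε) / δ) := ⟨_, rfl⟩
    have hRc : Continuous R := by rw [hRdef]; fun_prop
    have h1 : δ * (L - 0) - 0 ≤ (L + 0) * nichG m p a (R 0) := by
      refine eps_lim (f := fun ε => δ * (L - ε) - ε)
        (g := fun ε => (L + ε) * nichG m p a (R ε)) (by fun_prop) (by fun_prop) ?_
      filter_upwards [self_mem_nhdsWithin] with ε hε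
      have hε : 0 < ε := hε
      obtain ⟨t, ⟨h1, h2⟩, h3, h4, h5, h6⟩ := ((hfu ε hε).and_eventually (hpast ε hε)).exists
      have ht0 : 0 ≤ t := by linarith
      obtain ⟨c, hc⟩ : ∃ c, c = (L + ε) * nichG m p a (l - ε) / δ := ⟨_, rfl⟩
      have hcδ : (L + ε) * nichG m p a (l - ε) = δ * c := by rw [hc]; field_simp
      have hxc : L + ε ≤ c := by
        rw [hc, le_div_iff₀ hδ]
        have : δ ≤ nichG m p a (l - ε) := by rw [← hGK]; exact hanti (by linarith)
        exact mul_le_mul_of_nonneg_left this (by linarith)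
      have hRe : R ε = c + exp (δ * (ζ + ε)) * ((L - ε) - c) := by rw [hRdef, hc]
      have hxt : x t ≤ L + ε := h5 t (by linarith)
      have := nichF_le (x := x) (τd := τd) (σd := σd) (t := t) (lo := R ε) (hi := L + ε)
        h.hp h.ha (by linarith)
        (fun j => h5 _ (by linarith [(h.hτ j t ht0).2]))
        (fun j => by
          have h7 := h.past_upper h3 (h.hσ j t ht0).1 (h.hσ j t ht0).2 h4 h5 (by linarith) hcδ
          have h8 : exp (δ * (B t - B (t - σd j t))) ≤ exp (δ * (ζ + ε)) := by
            have := h6 j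
            gcongr
          have h9 := mul_le_mul_of_nonpos_right h8 (by linarith : x t - c ≤ 0)
          have h10 : exp (δ * (ζ + ε)) * (L - ε - c) ≤ exp (δ * (ζ + ε)) * (x t - c) := by
            gcongr
          rw [hRe]
          linarith)
      nlinarith
    simp only [sub_zero, add_zero] at h1
    rw [mul_comm] at h1
    have h2 := le_of_mul_le_mul_left h1 (by linarith)
    rw [← hGK] at h2
    have h3 := hsa.le_iff_ge.1 h2
    rw [hRdef] at h3
    simp only [sub_zero, add_zero] at h3
    exact h3
  have hS : K ≤ l * nichG m p a L / δ + exp (δ * ζ) * (l - l * nichG m p a L / δ) := by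
    obtain ⟨S, hSdef⟩ : ∃ S : ℝ → ℝ, S = fun ε => (l - ε) * nichG m p a (L + ε) / δ +
      exp (δ * (ζ + ε)) * ((l + ε) - (l - ε) * nichG m p a (L + ε) / δ) := ⟨_, rfl⟩
    have hSc : Continuous S := by rw [hSdef]; fun_prop
    have h1 : (l - 0) * nichG m p a (S 0) ≤ δ * (l + 0) + 0 := by
      refine eps_lim (g := fun ε => δ * (l + ε) + ε)
        (f := fun ε => (l - ε) * nichG m p a (S ε)) (by fun_prop) (by fun_prop) ?_
      filter_upwards [Ioo_mem_nhdsGT hl0] with ε hε'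
      have hε : 0 < ε := hε'.1
      have hεl := hε'.2
      obtain ⟨t, ⟨h1, h2⟩, h3, h4, h5, h6⟩ := ((hfl ε hε).and_eventually (hpast ε hε)).exists
      have ht0 : 0 ≤ t := by linarith
      obtain ⟨c, hc⟩ : ∃ c, c = (l - ε) * nichG m p a (L + ε) / δ := ⟨_, rfl⟩
      have hcδ : (l - ε) * nichG m p a (L + ε) = δ * c := by rw [hc]; field_simp
      have hxc : c ≤ l - ε := by
        rw [hc, div_le_iff₀ hδ]
        have : nichG m p a (L + ε) ≤ δ := by rw [← hGK]; exact hanti (by linarith)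
        exact mul_le_mul_of_nonneg_left this (by linarith)
      have hSe : S ε = c + exp (δ * (ζ + ε)) * ((l + ε) - c) := by rw [hSdef, hc]
      have hxt : l - ε ≤ x t := h4 t (by linarith)
      have := nichF_ge (x := x) (τd := τd) (σd := σd) (t := t) (lo := l - ε) (hi := S ε)
        h.hp h.ha (by linarith)
        (fun j => h4 _ (by linarith [(h.hτ j t ht0).2]))
        (fun j => by
          have h7 := h.past_lower h3 (h.hσ j t ht0).1 (h.hσ j t ht0).2 h4 h5 (by linarith) hcδ
          have h8 : exp (δ * (B t - B (t - σd j t))) ≤ exp (δ * (ζ + ε)) := by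
            have := h6 j
            gcongr
          have h9 := mul_le_mul_of_nonpos_right h8 (by linarith : c - x t ≤ 0)
          have h10 : exp (δ * (ζ + ε)) * (c - (l + ε)) ≤ exp (δ * (ζ + ε)) * (c - x t) := by
            gcongr
          rw [hSe]
          linarith)
      nlinarith
    simp only [sub_zero, add_zero] at h1
    rw [mul_comm δ] at h1
    have h2 := le_of_mul_le_mul_left h1 (by linarith)
    rw [← hGK] at h2
    have h3 := hsa.le_iff_ge.1 h2
    rw [hSdef] at h3
    simp only [sub_zero, add_zero] at h3
    exact h3
  have hζ0 : 0 ≤ ζ := by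
    refine le_of_forall_pos_le_add fun ε hε => ?_
    obtain ⟨t, h1, h2⟩ := ((hζ ε hε).and (eventually_ge_atTop 0)).exists
    have h3 := h1 ⟨0, h.hm⟩
    have h4 := h.Bmono (show t - σd ⟨0, h.hm⟩ t ≤ t by linarith [(h.hσ ⟨0, h.hm⟩ t h2).1])
    linarith
  have hθ : 0 ≤ exp (δ * ζ) - 1 := by
    have := Real.one_le_exp (mul_nonneg hδ.le hζ0)
    linarith
  have hA0 : 0 < A := lt_of_lt_of_le (h.ha ⟨0, h.hm⟩) (hA _)
  have hGl : nichG m p a l ≤ δ * exp (A * (K - l)) := by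
    rw [← hGK]
    unfold nichG
    rw [Finset.sum_mul]
    refine Finset.sum_le_sum fun j _ => ?_
    rw [mul_assoc, ← Real.exp_add]
    refine mul_le_mul_of_nonneg_left (Real.exp_le_exp.2 ?_) (h.hp j).le
    nlinarith [mul_le_mul_of_nonneg_right (hA j) (by linarith : 0 ≤ K - l)]
  have hGL : δ * exp (-(A * (L - K))) ≤ nichG m p a L := by
    rw [← hGK]
    unfold nichG
    rw [Finset.sum_mul]
    refine Finset.sum_le_sum fun j _ => ?_
    rw [mul_assoc, ← Real.exp_add]
    refine mul_le_mul_of_nonneg_left (Real.exp_le_exp.2 ?_) (h.hp j).le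
    nlinarith [mul_le_mul_of_nonneg_right (hA j) (by linarith : 0 ≤ L - K)]
  have hfin := nich_alg (l := l) (K := K) (L := L) (A := A) (θ := exp (δ * ζ) - 1)
    hl0 hlK hKL hA0 hH
    (by
      have h1 : nichG m p a l / δ ≤ exp (A * (K - l)) := by
        rw [div_le_iff₀ hδ]; linarith
      have h2 := mul_le_mul_of_nonneg_left h1 (mul_nonneg hL0.le hθ)
      rw [mul_div_assoc] at hR
      linarith)
    (by
      have h1 : exp (-(A * (L - K))) ≤ nichG m p a L / δ := by
        rw [le_div_iff₀ hδ]; linarith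
      have h2 := mul_le_mul_of_nonneg_left h1 (mul_nonneg hl0.le hθ)
      rw [mul_div_assoc] at hS
      linarith)
  exact tendsto_of_le_liminf_of_limsup_le (by rw [← hl]; exact hfin.2.ge)
    (by rw [← hL]; exact hfin.1.le) bA bB

end NichCore
end

/-- For (**) with `p = ∑ j, p j > δ`, (H0)--(H2) and (H3)
`a⁺K(e^{δζ⁺} - 1) ≤ 1` — in particular if `(a⁺/a⁻)(e^{δζ⁺} - 1) log(p/δ) ≤ 1` —
where `ζ⁺ = max_j limsup_{t→∞} ∫_{t-σ_j(t)}^t β(s) ds`, the positive equilibrium `K`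
(defined by `∑ j, p j e^{-a_j K} = δ`) is globally attractive. -/
theorem global_attractivity_for_eq_star_star
    (m : ℕ) (hm : 0 < m) (β : ℝ → ℝ) (δ : ℝ) (p a : Fin m → ℝ)
    (τd σd : Fin m → ℝ → ℝ) (τ : ℝ)
    (hH0 : HypH0 m β δ p a τd σd) (hτ : IsMaxDelayB m τd σd τ)
    (hp : δ < ∑ j, p j)
    (hH1 : HypH1 β)
    (hH2 : Filter.IsBoundedUnder (· ≤ ·) Filter.atTop (fun t => ∫ s in t - τ..t, β s))
    (aminus aplus : ℝ)
    (haminus : IsLeast (Set.range a) aminus) (haplus : IsGreatest (Set.range a) aplus)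
    (K : ℝ) (hKpos : 0 < K) (hK : (∑ j, p j * Real.exp (-(a j * K))) = δ)
    (ζplus : ℝ)
    (hζ : IsGreatest {r : ℝ | ∃ j : Fin m,
        r = Filter.limsup (fun t => ∫ s in (t - σd j t)..t, β s) Filter.atTop} ζplus)
    (hH3 : aplus * K * (Real.exp (δ * ζplus) - 1) ≤ 1 ∨
      (aplus / aminus) * (Real.exp (δ * ζplus) - 1) * Real.log ((∑ j, p j) / δ) ≤ 1) :
    ∀ x : ℝ → ℝ, IsPosSolB m β δ p a τd σd τ x →
      Filter.Tendsto x Filter.atTop (nhds K) := by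
  intro x hx
  obtain ⟨hδ, hpj, haj, ⟨hβc, hβpos⟩, hdel⟩ := hH0
  obtain ⟨hxc, hxn, hx0, hxd⟩ := hx
  have hub : ∀ j : Fin m, ∀ t : ℝ, 0 ≤ t → τd j t ≤ τ ∧ σd j t ≤ τ := fun j t ht =>
    ⟨hτ.1 ⟨j, t, ht, Or.inl rfl⟩, hτ.1 ⟨j, t, ht, Or.inr rfl⟩⟩
  have hnn : ∀ j : Fin m, ∀ t : ℝ, 0 ≤ t → 0 ≤ τd j t ∧ 0 ≤ σd j t := fun j t ht =>
    (hdel j).2.2.1 t ht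
  have hτ0 : 0 ≤ τ := (hnn ⟨0, hm⟩ 0 le_rfl).1.trans (hub ⟨0, hm⟩ 0 le_rfl).1
  set b : ℝ → ℝ := fun t => β (max t 0) with hb
  have hbc : Continuous b :=
    hβc.comp_continuous (by fun_prop) (fun t => mem_Ici.2 (le_max_right t 0))
  have hbpos : ∀ t, 0 < b t := fun t => hβpos _ (le_max_right t 0)
  have hbβ : ∀ t, 0 ≤ t → b t = β t := fun t ht => by simp only [hb, max_eq_left ht]
  set B : ℝ → ℝ := fun t => ∫ s in (0:ℝ)..t, b s with hB
  have hBd : ∀ t, HasDerivAt B (b t) t := fun t => (hbc.integral_hasStrictDerivAt 0 t).hasDerivAt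
  have hint : ∀ s t, 0 ≤ s → 0 ≤ t → ∫ r in s..t, β r = B t - B s := by
    intro s t hs ht
    have h1 : ∫ r in s..t, β r = ∫ r in s..t, b r := by
      refine intervalIntegral.integral_congr fun r hr => ?_
      exact (hbβ r (le_trans (le_min hs ht) hr.1)).symm
    rw [h1]
    exact (intervalIntegral.integral_interval_sub_left (hbc.intervalIntegrable _ _)
      (hbc.intervalIntegrable _ _)).symm
  have hBmono : Monotone B := monotone_of_deriv_nonneg
    (fun t => (hBd t).differentiableAt) (fun t => by rw [(hBd t).deriv]; exact (hbpos t).le)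
  have hBtop : Tendsto B atTop atTop := by
    refine Tendsto.congr' ?_ hH1
    filter_upwards [eventually_ge_atTop 0] with t ht
    rw [hint 0 t le_rfl ht]
    simp [hB]
  obtain ⟨C, hC⟩ := hH2
  rw [eventually_map] at hC
  obtain ⟨S, hS⟩ := eventually_atTop.1 hC
  have core : NichCore m δ p a τd σd τ b B x C (max S τ) :=
    { hm := hm
      hδ := hδ
      hp := hpj
      ha := haj
      τ0 := hτ0
      hτ := fun j t ht => ⟨(hnn j t ht).1, (hub j t ht).1⟩
      hσ := fun j t ht => ⟨(hnn j t ht).2, (hub j t ht).2⟩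
      bpos := hbpos
      Bd := hBd
      Btop := hBtop
      xc := hxc
      xn := hxn
      x0 := hx0
      xd := fun t ht => by
        have := (hxd t ht.le).hasDerivAt (Ici_mem_nhds ht)
        rw [hbβ t ht.le]
        exact this
      Tτ := le_max_right _ _
      hC := fun t ht => by
        have h1 : τ ≤ t := (le_max_right _ _).trans ht
        rw [← hint (t - τ) t (by linarith) (by linarith)]
        exact hS t ((le_max_left _ _).trans ht) }
  have hζ' : ∀ ε, 0 < ε → ∀ᶠ t in atTop, ∀ j, B t - B (t - σd j t) ≤ ζplus + ε := by
    intro ε hε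
    rw [eventually_all]
    intro j
    have hev : ∀ᶠ t in atTop, (∫ s in (t - σd j t)..t, β s) = B t - B (t - σd j t) := by
      filter_upwards [eventually_ge_atTop τ] with t ht
      have ht0 : 0 ≤ t := by linarith
      exact hint _ _ (by linarith [(hub j t ht0).2]) ht0
    have hbd : IsBoundedUnder (· ≤ ·) atTop (fun t => ∫ s in (t - σd j t)..t, β s) := by
      refine ⟨C, ?_⟩
      rw [eventually_map]
      filter_upwards [hev, eventually_ge_atTop (max S τ)] with t h1 h2
      have ht0 : 0 ≤ t := hτ0.trans ((le_max_right _ _).trans h2)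
      have h3 := core.hC t h2
      have h4 := hBmono (show t - τ ≤ t - σd j t by linarith [(hub j t ht0).2])
      rw [h1]
      linarith
    have hle := hζ.2 ⟨j, rfl⟩
    have hlt := eventually_lt_of_limsup_lt (b := ζplus + ε) (lt_of_le_of_lt hle (by linarith)) hbd
    filter_upwards [hev, hlt] with t h1 h2
    rw [← h1]
    exact h2.le
  have hA : ∀ j, a j ≤ aplus := fun j => haplus.2 ⟨j, rfl⟩
  refine core.attract hKpos hK hζ' hA ?_
  rcases hH3 with h3 | h3
  · linarith
  · have ham : 0 < aminus := by
      obtain ⟨j, hj⟩ := haminus.1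
      rw [← hj]
      exact haj j
    have hap : 0 < aplus := lt_of_lt_of_le (haj ⟨0, hm⟩) (hA _)
    have hζ0 : 0 ≤ ζplus := by
      refine le_of_forall_pos_le_add fun ε hε => ?_
      obtain ⟨t, h1, h2⟩ := ((hζ' ε hε).and (eventually_ge_atTop 0)).exists
      have h3 := h1 ⟨0, hm⟩
      have h4 := hBmono (show t - σd ⟨0, hm⟩ t ≤ t by linarith [(hnn ⟨0, hm⟩ t h2).2])
      linarith
    have hθ : 0 ≤ exp (δ * ζplus) - 1 := by
      have := Real.one_le_exp (mul_nonneg hδ.le hζ0)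
      linarith
    have hKle : aminus * K ≤ Real.log ((∑ j, p j) / δ) := by
      rw [Real.le_log_iff_exp_le (div_pos (hδ.trans hp) hδ), le_div_iff₀ hδ]
      have h5 : δ ≤ (∑ j, p j) * exp (-(aminus * K)) := by
        rw [← hK, Finset.sum_mul]
        refine Finset.sum_le_sum fun j _ => ?_
        refine mul_le_mul_of_nonneg_left (Real.exp_le_exp.2 ?_) (hpj j).le
        have := mul_le_mul_of_nonneg_right (haminus.2 ⟨j, rfl⟩ : aminus ≤ a j) hKpos.le
        linarith
      calc exp (aminus * K) * δ ≤ exp (aminus * K) * ((∑ j, p j) * exp (-(aminus * K))) := by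
            gcongr
        _ = (∑ j, p j) * (exp (aminus * K) * exp (-(aminus * K))) := by ring
        _ = ∑ j, p j := by rw [← Real.exp_add]; simp
    refine le_trans ?_ h3
    calc (exp (δ * ζplus) - 1) * (aplus * K)
        = (aplus / aminus) * (exp (δ * ζplus) - 1) * (aminus * K) := by field_simp
      _ ≤ _ := by
        have : 0 ≤ aplus / aminus * (exp (δ * ζplus) - 1) := mul_nonneg (by positivity) hθ
        gcongr
end
end
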